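/- Let Ω ⊂ ℝ² be a bounded C² domain with outer boundary Γ₀, outer perimeter L₀ := H¹(Γ₀), and inner radius R of the region enclosed by Γ₀. Then for almost every t ∈ [0, R], the inner level-curve length satisfies L(t) ≤ L₀ − 2π·t, where L(t) := H¹({x ∈ Ω : dist(x, Γ₀) = t}). -/

import Mathlib

open MeasureTheory Metric Filter Asymptotics Real RealInnerProductSpace

noncomputable section

abbrev Eu (d : ℕ) := EuclideanSpace ℝ (Fin d)

/-- A `C²` Jordan curve in the plane: a periodic, regular, `C²` curve which is
injective on a period. -/
def IsC2JordanCurve (γ : ℝ → Eu 2) : Prop :=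
  ContDiff ℝ 2 γ ∧ Function.Periodic γ 1 ∧
  (∀ s ∈ Set.Ico (0 : ℝ) 1, ∀ t ∈ Set.Ico (0 : ℝ) 1, γ s = γ t → s = t) ∧
  ∀ t, deriv γ t ≠ 0

/-- A bounded planar `C²` domain: a bounded open connected set whose boundary is a
finite disjoint union of `C²` Jordan curves. -/
def IsC2Domain (Ω : Set (Eu 2)) : Prop :=
  IsOpen Ω ∧ IsConnected Ω ∧ Bornology.IsBounded Ω ∧
  ∃ (N : ℕ) (γ : Fin N → ℝ → Eu 2),
    (∀ i, IsC2JordanCurve (γ i)) ∧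
    (∀ i j, i ≠ j → Disjoint (Set.range (γ i)) (Set.range (γ j))) ∧
    frontier Ω = ⋃ i, Set.range (γ i)

/-- The unbounded connected component of the complement of the closure of `Ω`. -/
def unboundedPart (Ω : Set (Eu 2)) : Set (Eu 2) :=
  {x | x ∈ (closure Ω)ᶜ ∧ ¬ Bornology.IsBounded (connectedComponentIn (closure Ω)ᶜ x)}

/-- The outer boundary `Γ₀` of `Ω`: the boundary of the unbounded component of the
complement of the closure of `Ω`. -/
def outerBoundary (Ω : Set (Eu 2)) : Set (Eu 2) :=
  frontier (unboundedPart Ω)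

/-- The open region `Ω₀` enclosed by the outer boundary of `Ω`. -/
def innerRegion (Ω : Set (Eu 2)) : Set (Eu 2) :=
  (closure (unboundedPart Ω))ᶜ

/-- The inner radius `R` of the region enclosed by the outer boundary of `Ω`. -/
def innerRadius (Ω : Set (Eu 2)) : ℝ :=
  sSup ((fun x => infDist x (outerBoundary Ω)) '' innerRegion Ω)

/-- The outer perimeter `L₀ = H¹(Γ₀)`. -/
def outerPerim (Ω : Set (Eu 2)) : ℝ :=
  (μH[1] (outerBoundary Ω)).toReal

/-- `A(t)`, the area of the part of the `t`-neighbourhood of the outer boundary lying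
inside `Ω`. -/
def areaFn (Ω : Set (Eu 2)) (t : ℝ) : ℝ :=
  (volume {x ∈ Ω | infDist x (outerBoundary Ω) < t}).toReal

/-- `L(t)`, the length of the part of the level curve at distance `t` from the outer
boundary that lies inside `Ω`. -/
def lenFn (Ω : Set (Eu 2)) (t : ℝ) : ℝ :=
  (μH[1] {x ∈ Ω | infDist x (outerBoundary Ω) = t}).toReal

/-- A finite "graph" inequality: if a coboundary operator `D` has only trivial kernel modulo the
value at one vertex and its range misses some coordinate direction, there are at least as many
edges as vertices. -/
theorem card_le_card_of_coboundary {ι κ : Type*} [Fintype ι] [Fintype κ] [DecidableEq κ]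
    (D : (ι → ℝ) →ₗ[ℝ] (κ → ℝ)) (lam : (κ → ℝ) →ₗ[ℝ] ℝ) (e₀ : κ) (v₀ : ι)
    (h₁ : ∀ f, lam (D f) = 0) (h₂ : lam (Pi.single e₀ 1) ≠ 0)
    (h₃ : ∀ f, D f = 0 → f v₀ = 0 → f = 0) : Fintype.card ι ≤ Fintype.card κ := by
  let P : (ι → ℝ) →ₗ[ℝ] (κ → ℝ) :=
    D + (LinearMap.toSpanSingleton ℝ (κ → ℝ) (Pi.single e₀ 1)).comp (LinearMap.proj v₀)
  have hP : ∀ f, P f = D f + f v₀ • Pi.single e₀ 1 := fun f => rfl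
  have hinj : Function.Injective P := by
    rw [← LinearMap.ker_eq_bot, LinearMap.ker_eq_bot']
    intro f hf
    rw [hP] at hf
    have h := congrArg lam hf
    rw [map_add, h₁, map_smul, map_zero, zero_add, smul_eq_mul] at h
    have hv : f v₀ = 0 := by simpa [h₂] using h
    rw [hv, zero_smul, add_zero] at hf
    exact h₃ f hf hv
  simpa using LinearMap.finrank_le_finrank_of_injective hinj

/-- The number of marks strictly to the left of `u`. -/
def countLt (q : Finset ℝ) (u : ℝ) : ℕ := (q.filter (· < u)).card

/-- The number of marks weakly to the left of `u`. -/
def countLe (q : Finset ℝ) (u : ℝ) : ℕ := (q.filter (· ≤ u)).card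

theorem countLt_le (q : Finset ℝ) (u : ℝ) : countLt q u ≤ q.card := Finset.card_filter_le _ _

theorem countLe_le (q : Finset ℝ) (u : ℝ) : countLe q u ≤ q.card := Finset.card_filter_le _ _

theorem countLt_eq_zero {q : Finset ℝ} {u : ℝ} (h : ∀ x ∈ q, u ≤ x) : countLt q u = 0 := by
  rw [countLt, Finset.card_eq_zero, Finset.filter_eq_empty_iff]
  intro x hx
  exact not_lt.2 (h x hx)

theorem countLt_eq_card {q : Finset ℝ} {u : ℝ} (h : ∀ x ∈ q, x < u) : countLt q u = q.card := by
  rw [countLt, Finset.filter_true_of_mem h]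

theorem exists_countLt_eq {q : Finset ℝ} {S : Set ℝ}
    (hl : ∃ u ∈ S, ∀ x ∈ q, u ≤ x) (hr : ∃ u ∈ S, ∀ x ∈ q, x < u)
    (hm : ∀ x ∈ q, ∀ y ∈ q, x < y → ∃ u ∈ S, x < u ∧ u < y) {j : ℕ} (hj : j ≤ q.card) :
    ∃ u ∈ S, countLt q u = j := by
  classical
  rcases Nat.eq_zero_or_pos j with rfl | hj0
  · obtain ⟨u, hu, h⟩ := hl
    exact ⟨u, hu, countLt_eq_zero h⟩
  rcases hj.eq_or_lt with rfl | hj1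
  · obtain ⟨u, hu, h⟩ := hr
    exact ⟨u, hu, countLt_eq_card h⟩
  let e := q.orderEmbOfFin rfl
  have hlt : e ⟨j - 1, by omega⟩ < e ⟨j, hj1⟩ := by
    apply e.strictMono
    rw [Fin.mk_lt_mk]
    omega
  obtain ⟨u, hu, h1, h2⟩ := hm _ (q.orderEmbOfFin_mem rfl _) _ (q.orderEmbOfFin_mem rfl _) hlt
  refine ⟨u, hu, ?_⟩
  have : q.filter (· < u) = (Finset.univ.filter (fun i : Fin q.card => i < ⟨j, hj1⟩)).map
      e.toEmbedding := by
    ext x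
    simp only [Finset.mem_filter, Finset.mem_map, Finset.mem_univ, true_and]
    constructor
    · rintro ⟨hx, hxu⟩
      have hx' : x ∈ Set.range (q.orderEmbOfFin rfl) := by
        rw [Finset.range_orderEmbOfFin]; exact hx
      obtain ⟨i, rfl⟩ := hx'
      refine ⟨i, ?_, rfl⟩
      by_contra hc
      exact absurd (hxu.trans h2) (not_lt.2 (e.monotone (not_lt.1 hc)))
    · rintro ⟨i, hi, rfl⟩
      refine ⟨q.orderEmbOfFin_mem rfl _, lt_of_le_of_lt (e.monotone ?_) h1⟩
      rw [Fin.le_def]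
      rw [Fin.lt_def] at hi
      simp only at hi ⊢
      omega
  rw [countLt, this, Finset.card_map]
  rw [Finset.filter_gt_eq_Iio, Fin.card_Iio]

theorem countLt_congr {q : Finset ℝ} {u v : ℝ} (huv : u ≤ v)
    (h : ∀ x ∈ q, u ≤ x → ¬ x < v) : countLt q u = countLt q v := by
  rw [countLt, countLt]
  congr 1
  apply Finset.filter_congr
  intro x hx
  exact ⟨fun h' => h'.trans_le huv, fun h' => by
    by_contra hc
    exact h x hx (not_lt.1 hc) h'⟩

theorem not_mem_of_countLe_eq {q : Finset ℝ} {u v : ℝ} (huv : u ≤ v)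
    (h : countLe q u = countLe q v) {x : ℝ} (hx : x ∈ q) (h1 : u < x) : ¬ x ≤ v := by
  intro h2
  have hsub : q.filter (· ≤ u) ⊆ q.filter (· ≤ v) := by
    intro y
    simp only [Finset.mem_filter]
    exact fun hy => ⟨hy.1, hy.2.trans huv⟩
  have := Finset.eq_of_subset_of_card_le hsub h.ge
  have hx' : x ∈ q.filter (· ≤ v) := Finset.mem_filter.2 ⟨hx, h2⟩
  rw [← this] at hx'
  exact absurd (Finset.mem_filter.1 hx').2 (not_le.2 h1)

theorem continuousOn_countLt {X : Type*} [TopologicalSpace X] {S : Set X} {ξ : X → ℝ}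
    (hξ : Continuous ξ) {q : Finset ℝ} (h : ∀ x ∈ S, ∀ p ∈ q, ξ x ≠ p) :
    ContinuousOn (fun x => countLt q (ξ x)) S := by
  intro x hx
  apply ContinuousAt.continuousWithinAt
  have : ∀ᶠ y in nhds x, ∀ p ∈ q, (p < ξ y ↔ p < ξ x) := by
    rw [Filter.eventually_all_finset]
    intro p hp
    rcases lt_or_gt_of_ne (h x hx p hp) with hlt | hgt
    · filter_upwards [hξ.continuousAt.eventually (gt_mem_nhds hlt)] with y hy
      exact ⟨fun h' => absurd h' hy.le.not_gt, fun h' => absurd h' hlt.le.not_gt⟩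
    · filter_upwards [hξ.continuousAt.eventually (lt_mem_nhds hgt)] with y hy
      exact ⟨fun _ => hgt, fun _ => hy⟩
  apply continuousAt_const.congr (f := fun _ => countLt q (ξ x))
  filter_upwards [this] with y hy
  rw [countLt, countLt]
  congr 1
  exact Finset.filter_congr fun p hp => (hy p hp).symm

/-- The `k`-th of the `m + 1` slabs cut out by the levels `l 1 < ... < l m`. -/
def slab {E : Type*} (h : E → ℝ) (l : ℕ → ℝ) (m k : ℕ) : Set E :=
  {x | (k = 0 ∨ l k ≤ h x) ∧ (k = m ∨ h x ≤ l (k + 1))}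

theorem isClosed_slab {E : Type*} [TopologicalSpace E] {h : E → ℝ} (hh : Continuous h)
    (l : ℕ → ℝ) (m k : ℕ) : IsClosed (slab h l m k) := by
  apply IsClosed.inter
  · change IsClosed {x | k = 0 ∨ l k ≤ h x}
    by_cases hk : k = 0
    · simp [hk]
    · simpa [hk] using isClosed_le continuous_const hh
  · change IsClosed {x | k = m ∨ h x ≤ l (k + 1)}
    by_cases hk : k = m
    · simp [hk]
    · simpa [hk] using isClosed_le hh continuous_const

theorem exists_mem_slab {E : Type*} (h : E → ℝ) (l : ℕ → ℝ) (m : ℕ) (x : E) :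
    ∃ k ≤ m, x ∈ slab h l m k := by
  classical
  by_cases H : ∃ k, k < m ∧ h x ≤ l (k + 1)
  · obtain ⟨h1, h2⟩ := Nat.find_spec H
    refine ⟨Nat.find H, h1.le, ?_, Or.inr h2⟩
    rcases Nat.eq_zero_or_pos (Nat.find H) with h0 | h0
    · exact Or.inl h0
    · right
      have := Nat.find_min H (m := Nat.find H - 1) (by omega)
      rw [Nat.sub_add_cancel h0] at this
      by_contra hc
      exact this ⟨by omega, (not_le.1 hc).le⟩
  · refine ⟨m, le_rfl, ?_, Or.inl rfl⟩
    rcases Nat.eq_zero_or_pos m with h0 | h0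
    · exact Or.inl h0
    · right
      push Not at H
      have := H (m - 1) (by omega)
      rw [Nat.sub_add_cancel h0] at this
      exact this.le

theorem slab_inter {E : Type*} {h : E → ℝ} {l : ℕ → ℝ} (hl : StrictMono l) {m k k' : ℕ}
    (hk : k' ≤ m) (hlt : k < k') {x : E} (hx : x ∈ slab h l m k) (hx' : x ∈ slab h l m k') :
    k' = k + 1 ∧ h x = l (k + 1) := by
  have h1 : h x ≤ l (k + 1) := hx.2.resolve_left (by omega)
  have h2 : l k' ≤ h x := hx'.1.resolve_left (by omega)
  have h3 : k' ≤ k + 1 := hl.le_iff_le.1 (h2.trans h1)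
  have h4 : k' = k + 1 := by omega
  subst h4
  exact ⟨rfl, le_antisymm h1 h2⟩

theorem exists_far_left (M : ℝ) (q : Finset ℝ) : ∃ u, u ≤ -M ∧ ∀ x ∈ q, u ≤ x := by
  obtain ⟨b, hb⟩ := q.bddBelow
  exact ⟨min (-M) b, min_le_left _ _, fun x hx => (min_le_right _ _).trans (hb hx)⟩

theorem exists_far_right (M : ℝ) (q : Finset ℝ) : ∃ u, M ≤ u ∧ ∀ x ∈ q, x < u := by
  obtain ⟨b, hb⟩ := q.bddAbove
  exact ⟨max M (b + 1), le_max_left _ _, fun x hx =>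
    ((hb hx).trans_lt (lt_add_one b)).trans_le (le_max_right _ _)⟩

/-- Counting marks in slabs against boundary points on the levels separating them. -/
theorem sum_card_add_one_le {E : Type*} [TopologicalSpace E] {h ξ : E → ℝ} {pt : ℝ → ℝ → E}
    (hh : Continuous h) (hξ : Continuous ξ) (hpt : ∀ a b, h (pt a b) = a)
    (ξpt : ∀ a b, ξ (pt a b) = b) (pth : ∀ x, pt (h x) (ξ x) = x)
    {C : Set E} (hC : IsClosed C) (hCc : IsPreconnected C) {M : ℝ}
    (hM : ∀ x ∉ C, |ξ x| < M) {l : ℕ → ℝ} (hl : StrictMono l) {m : ℕ}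
    {q Z : ℕ → Finset ℝ} (q0 : q 0 = ∅) (qm : q m = ∅)
    (hq1 : ∀ k, 0 < k → k < m → ∀ p ∈ q k, ∀ y ∈ Set.Icc (l k) (l (k + 1)), pt y p ∉ C)
    (hq2 : ∀ k, 0 < k → k < m → ∀ p ∈ q k, ∀ p' ∈ q k, p < p' →
      ∃ z ∈ C, h z ∈ Set.Icc (l k) (l (k + 1)) ∧ p < ξ z ∧ ξ z < p')
    (hZ : ∀ k < m, ∀ x y, x < y → pt (l (k + 1)) y ∈ C → pt (l (k + 1)) x ∉ C →
      ∃ z ∈ Z k, x < z ∧ z ≤ y)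
    {k₀ : ℕ} (hk₀ : k₀ < m) {x₀ : ℝ} (hx₀ : pt (l (k₀ + 1)) x₀ ∉ C) :
    ∑ k ∈ Finset.range (m + 1), (q k).card + 1 ≤ ∑ k ∈ Finset.range m, (Z k).card := by
  classical
  have hM' : ∀ a b, M ≤ |b| → pt a b ∈ C := by
    intro a b hb
    by_contra hc
    have := hM _ hc
    rw [ξpt] at this
    exact absurd hb (not_le.2 this)
  have hM0 : 0 < M := (abs_nonneg _).trans_lt (hM _ hx₀)
  set n : ℕ → E → ℕ := fun k x => countLt (q k) (ξ x) with hn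
  set e : ℕ → E → ℕ := fun k x => countLe (Z k) (ξ x) with he
  -- marks are never met inside `C`
  have hne : ∀ k ≤ m, ∀ x ∈ C ∩ slab h l m k, ∀ p ∈ q k, ξ x ≠ p := by
    rintro k hk x ⟨hxC, hxs⟩ p hp rfl
    rcases Nat.eq_zero_or_pos k with rfl | h0
    · simp [q0] at hp
    rcases hk.eq_or_lt with rfl | hkm
    · simp [qm] at hp
    exact hq1 k h0 hkm _ hp (h x) ⟨hxs.1.resolve_left h0.ne', hxs.2.resolve_left hkm.ne⟩
      (by rwa [pth])
  have hseg : ∀ k < m, ∀ x ∈ C, ∀ y ∈ C, h x = l (k + 1) → h y = l (k + 1) → ξ x ≤ ξ y →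
      e k x = e k y → ∀ u, ξ x ≤ u → u ≤ ξ y → pt (l (k + 1)) u ∈ C := by
    intro k hk x hx y hy hhx hhy hxy hexy u hu1 hu2
    by_contra hc
    rcases hu2.eq_or_lt with rfl | hu2
    · rw [← hhy, pth] at hc; exact hc hy
    obtain ⟨z, hz, hz1, hz2⟩ := hZ k hk u (ξ y) hu2 (by rwa [← hhy, pth]) hc
    exact not_mem_of_countLe_eq hxy hexy hz (hu1.trans_lt hz1) hz2
  have hnn' : ∀ k < m, ∀ k', k' = k ∨ k' = k + 1 → ∀ x ∈ C, ∀ y ∈ C,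
      h x = l (k + 1) → h y = l (k + 1) → ξ x ≤ ξ y → e k x = e k y → n k' x = n k' y := by
    intro k hk k' hk' x hx y hy hhx hhy hxy hexy
    apply countLt_congr hxy
    intro p hp h1 h2
    have hp' := hseg k hk x hx y hy hhx hhy hxy hexy p h1 h2.le
    refine hne k' (by omega) _ ⟨hp', ?_, ?_⟩ p hp (ξpt _ _)
    · rw [hpt]
      right
      apply hl.monotone
      omega
    · rw [hpt]
      right
      apply hl.monotone
      omega
  have hnn : ∀ k < m, ∀ k', k' = k ∨ k' = k + 1 → ∀ x ∈ C, ∀ y ∈ C,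
      h x = l (k + 1) → h y = l (k + 1) → e k x = e k y → n k' x = n k' y := by
    intro k hk k' hk' x hx y hy hhx hhy hexy
    rcases le_total (ξ x) (ξ y) with hxy | hxy
    · exact hnn' k hk k' hk' x hx y hy hhx hhy hxy hexy
    · exact (hnn' k hk k' hk' y hy x hx hhy hhx hxy hexy.symm).symm
  -- vertices and edges
  let VS : Finset (Σ _ : ℕ, ℕ) := (Finset.range (m + 1)).sigma fun k => Finset.range ((q k).card + 1)
  let ES : Finset (Σ _ : ℕ, ℕ) := (Finset.range m).sigma fun k => Finset.range ((Z k).card + 1)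
  have hVS : ∀ k ≤ m, ∀ x, (⟨k, n k x⟩ : Σ _ : ℕ, ℕ) ∈ VS := by
    intro k hk x
    have := countLt_le (q k) (ξ x)
    simp only [VS, Finset.mem_sigma, Finset.mem_range]
    exact ⟨by omega, Nat.lt_succ_of_le this⟩
  have hES : ∀ k < m, ∀ x, (⟨k, e k x⟩ : Σ _ : ℕ, ℕ) ∈ ES := by
    intro k hk x
    have := countLe_le (Z k) (ξ x)
    simp only [ES, Finset.mem_sigma, Finset.mem_range]
    exact ⟨by omega, Nat.lt_succ_of_le this⟩
  have hnode : ∀ k ≤ m, ∀ j ≤ (q k).card, ∃ x ∈ C ∩ slab h l m k, n k x = j := by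
    intro k hk j hj
    have hy : ∃ y, (k = 0 ∨ l k ≤ y) ∧ (k = m ∨ y ≤ l (k + 1)) := by
      exact ⟨l k, Or.inr le_rfl, Or.inr (hl (Nat.lt_succ_self k)).le⟩
    obtain ⟨y, hy⟩ := hy
    have := exists_countLt_eq (q := q k) (S := ξ '' (C ∩ slab h l m k)) ?_ ?_ ?_ hj
    · obtain ⟨_, ⟨x, hx, rfl⟩, h'⟩ := this
      exact ⟨x, hx, h'⟩
    · obtain ⟨u, hu, hu'⟩ := exists_far_left M (q k)
      refine ⟨u, ⟨pt y u, ⟨hM' _ _ ?_, by simpa [slab, hpt] using hy⟩, ξpt _ _⟩, hu'⟩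
      rw [abs_of_nonpos (by linarith)]; linarith
    · obtain ⟨u, hu, hu'⟩ := exists_far_right M (q k)
      refine ⟨u, ⟨pt y u, ⟨hM' _ _ ?_, by simpa [slab, hpt] using hy⟩, ξpt _ _⟩, hu'⟩
      rw [abs_of_nonneg (by linarith)]; linarith
    · intro p hp p' hp' hpp
      rcases Nat.eq_zero_or_pos k with rfl | h0
      · simp [q0] at hp
      rcases hk.eq_or_lt with rfl | hkm
      · simp [qm] at hp
      obtain ⟨z, hz, hhz, h1, h2⟩ := hq2 k h0 hkm p hp p' hp' hpp
      exact ⟨ξ z, ⟨z, ⟨hz, Or.inr hhz.1, Or.inr hhz.2⟩, rfl⟩, h1, h2⟩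
  -- the coboundary operator
  let rep : (Σ _ : ℕ, ℕ) → E → Prop := fun p x => x ∈ C ∧ h x = l (p.1 + 1) ∧ e p.1 x = p.2
  let xt : (VS → ℝ) →ₗ[ℝ] ((Σ _ : ℕ, ℕ) → ℝ) :=
    { toFun := fun f p => if hp : p ∈ VS then f ⟨p, hp⟩ else 0
      map_add' := by
        intro f g; ext p; by_cases hp : p ∈ VS <;> simp [hp]
      map_smul' := by
        intro c f; ext p; by_cases hp : p ∈ VS <;> simp [hp] }
  let dd : (Σ _ : ℕ, ℕ) → (VS → ℝ) →ₗ[ℝ] ℝ := fun p =>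
    if hp : ∃ x, rep p x then
      (LinearMap.proj (⟨p.1 + 1, n (p.1 + 1) hp.choose⟩ : Σ _ : ℕ, ℕ)).comp xt -
        (LinearMap.proj (⟨p.1, n p.1 hp.choose⟩ : Σ _ : ℕ, ℕ)).comp xt
    else 0
  let D : (VS → ℝ) →ₗ[ℝ] (ES → ℝ) := LinearMap.pi fun p => dd p.1
  have hD : ∀ f, ∀ k < m, ∀ x ∈ C, h x = l (k + 1) → ∀ hp : (⟨k, e k x⟩ : Σ _ : ℕ, ℕ) ∈ ES,
      D f ⟨⟨k, e k x⟩, hp⟩ = xt f ⟨k + 1, n (k + 1) x⟩ - xt f ⟨k, n k x⟩ := by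
    intro f k hk x hx hhx hp
    have hp' : ∃ y, rep ⟨k, e k x⟩ y := ⟨x, hx, hhx, rfl⟩
    obtain ⟨h1, h2, h3⟩ := hp'.choose_spec
    have hDf : D f ⟨⟨k, e k x⟩, hp⟩ = dd ⟨k, e k x⟩ f := rfl
    rw [hDf]
    simp only [dd]
    rw [dif_pos hp']
    simp only [LinearMap.sub_apply, LinearMap.comp_apply, LinearMap.proj_apply]
    rw [hnn k hk (k + 1) (Or.inr rfl) _ h1 x hx h2 hhx h3,
      hnn k hk k (Or.inl rfl) _ h1 x hx h2 hhx h3]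
  -- the cycle functional
  let xL : ℕ → E := fun k => pt (l (k + 1)) (-M)
  let xR : ℕ → E := fun k => pt (l (k + 1)) M
  have hxL : ∀ k, xL k ∈ C := fun k => hM' _ _ (by rw [abs_neg]; exact le_abs_self _)
  have hxR : ∀ k, xR k ∈ C := fun k => hM' _ _ (le_abs_self _)
  have hqM : ∀ k ≤ m, ∀ p ∈ q k, |p| < M := by
    intro k hk p hp
    rcases Nat.eq_zero_or_pos k with rfl | h0
    · simp [q0] at hp
    rcases hk.eq_or_lt with rfl | hkm
    · simp [qm] at hp
    have := hM _ (hq1 k h0 hkm p hp (l k) ⟨le_rfl, (hl (Nat.lt_succ_self k)).le⟩)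
    rwa [ξpt] at this
  have hnL : ∀ k ≤ m, ∀ y, n k (pt y (-M)) = 0 := by
    intro k hk y
    apply countLt_eq_zero
    intro p hp
    rw [ξpt]
    exact (abs_lt.1 (hqM k hk p hp)).1.le
  have hnR : ∀ k ≤ m, ∀ y, n k (pt y M) = (q k).card := by
    intro k hk y
    apply countLt_eq_card
    intro p hp
    rw [ξpt]
    exact (abs_lt.1 (hqM k hk p hp)).2
  let lam : (ES → ℝ) →ₗ[ℝ] ℝ := ∑ k : Fin m,
    ((LinearMap.proj (⟨⟨k, e k (xL k)⟩, hES k k.2 _⟩ : ES) : (ES → ℝ) →ₗ[ℝ] ℝ) -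
      LinearMap.proj (⟨⟨k, e k (xR k)⟩, hES k k.2 _⟩ : ES))
  have hlam : ∀ g, lam g = ∑ k : Fin m, (g ⟨⟨k, e k (xL k)⟩, hES k k.2 _⟩ -
      g ⟨⟨k, e k (xR k)⟩, hES k k.2 _⟩) := by
    intro g
    simp only [lam, LinearMap.sum_apply, LinearMap.sub_apply, LinearMap.proj_apply]
  have hcard := card_le_card_of_coboundary D lam ⟨⟨k₀, e k₀ (xL k₀)⟩, hES k₀ hk₀ _⟩
    ⟨⟨0, 0⟩, by simp [VS]⟩ ?_ ?_ ?_
  · simp only [Fintype.card_coe, VS, ES, Finset.card_sigma, Finset.card_range,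
      Finset.sum_add_distrib, Finset.sum_const, smul_eq_mul, mul_one] at hcard
    omega
  · intro f
    rw [hlam]
    have : ∀ k : Fin m, D f ⟨⟨k, e k (xL k)⟩, hES k k.2 _⟩ - D f ⟨⟨k, e k (xR k)⟩, hES k k.2 _⟩ =
        (fun k : ℕ => (xt f ⟨k + 1, 0⟩ - xt f ⟨k, 0⟩) -
          (xt f ⟨k + 1, (q (k + 1)).card⟩ - xt f ⟨k, (q k).card⟩)) k := by
      intro k
      rw [hD f k k.2 _ (hxL k) (hpt _ _), hD f k k.2 _ (hxR k) (hpt _ _)]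
      have h1 := k.2
      simp only [xL, xR]
      rw [hnL _ (by omega), hnL _ (by omega), hnR _ (by omega), hnR _ (by omega)]
    rw [Finset.sum_congr rfl fun k _ => this k,
      Fin.sum_univ_eq_sum_range (fun k : ℕ => (xt f ⟨k + 1, 0⟩ - xt f ⟨k, 0⟩) -
          (xt f ⟨k + 1, (q (k + 1)).card⟩ - xt f ⟨k, (q k).card⟩)) m, Finset.sum_sub_distrib,
      Finset.sum_range_sub (fun k => xt f ⟨k, 0⟩),
      Finset.sum_range_sub (fun k => xt f ⟨k, (q k).card⟩), q0, qm]
    simp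
  · have hLR : e k₀ (xL k₀) ≠ e k₀ (xR k₀) := by
      intro hc
      have hx := hM _ hx₀
      rw [ξpt, abs_lt] at hx
      refine hx₀ (hseg k₀ hk₀ _ (hxL k₀) _ (hxR k₀) (hpt _ _) (hpt _ _) ?_ hc _ ?_ ?_)
      · simp only [xL, xR, ξpt]; linarith
      · simp only [xL, ξpt]; exact hx.1.le
      · simp only [xR, ξpt]; exact hx.2.le
    rw [hlam, Finset.sum_eq_single ⟨k₀, hk₀⟩]
    · simp only [Pi.single_apply, Subtype.mk.injEq, Sigma.mk.injEq]
      simp [Ne.symm hLR]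
    · intro k _ hk
      have hk' : (k : ℕ) ≠ k₀ := fun hc => hk (Fin.ext hc)
      simp [hk']
    · simp
  · intro f hf hf0
    have hx00 : xt f ⟨0, 0⟩ = 0 := by
      simp only [xt, LinearMap.coe_mk, AddHom.coe_mk]
      rw [dif_pos (by simp [VS])]
      exact hf0
    have hstep : ∀ k < m, ∀ x ∈ C, h x = l (k + 1) →
        xt f ⟨k + 1, n (k + 1) x⟩ = xt f ⟨k, n k x⟩ := by
      intro k hk x hx hhx
      have := hD f k hk x hx hhx (hES k hk x)
      rw [hf, Pi.zero_apply] at this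
      linarith
    have hall : ∀ k ≤ m, ∀ x ∈ C ∩ slab h l m k, ∀ k' ≤ m, x ∈ slab h l m k' →
        xt f ⟨k', n k' x⟩ = xt f ⟨k, n k x⟩ := by
      intro k hk x hx k' hk' hx'
      rcases lt_trichotomy k k' with hlt | rfl | hlt
      · obtain ⟨rfl, h2⟩ := slab_inter hl hk' hlt hx.2 hx'
        exact hstep k (by omega) x hx.1 h2
      · rfl
      · obtain ⟨rfl, h2⟩ := slab_inter hl hk hlt hx' hx.2
        exact (hstep k' (by omega) x hx.1 h2).symm
    -- closed pieces on which the extended function takes prescribed values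
    let part : Set ℝ → Set E := fun T =>
      ⋃ k ∈ Finset.range (m + 1), (C ∩ slab h l m k) ∩ (fun x => n k x) ⁻¹'
        {j | xt f ⟨k, j⟩ ∈ T}
    have hpart : ∀ T, IsClosed (part T) := by
      intro T
      apply isClosed_biUnion_finset
      intro k hk
      apply ContinuousOn.preimage_isClosed_of_isClosed _ (hC.inter (isClosed_slab hh l m k))
        (isClosed_discrete _)
      exact continuousOn_countLt hξ (hne k (by simpa [Nat.lt_succ_iff] using hk))
    have hmem : ∀ T x, x ∈ part T ↔ ∃ k ≤ m, x ∈ C ∩ slab h l m k ∧ xt f ⟨k, n k x⟩ ∈ T := by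
      intro T x
      simp only [part, Set.mem_iUnion, Finset.mem_range, Nat.lt_succ_iff, exists_prop]
      rfl
    have hcov : C ⊆ part {0} ∪ part {0}ᶜ := by
      intro x hx
      obtain ⟨k, hk, hxk⟩ := exists_mem_slab h l m x
      by_cases hv : xt f ⟨k, n k x⟩ = 0
      · exact Or.inl ((hmem _ _).2 ⟨k, hk, ⟨hx, hxk⟩, hv⟩)
      · exact Or.inr ((hmem _ _).2 ⟨k, hk, ⟨hx, hxk⟩, hv⟩)
    ext ⟨⟨k, j⟩, hkj⟩
    have hkj' := hkj
    simp only [VS, Finset.mem_sigma, Finset.mem_range, Nat.lt_succ_iff] at hkj'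
    obtain ⟨x, hx, hxj⟩ := hnode k hkj'.1 j hkj'.2
    obtain ⟨y, hy, hy0⟩ := hnode 0 (Nat.zero_le _) 0 (Nat.zero_le _)
    by_contra hc
    have hval : xt f ⟨k, n k x⟩ = f ⟨⟨k, j⟩, hkj⟩ := by
      simp only [hxj, xt, LinearMap.coe_mk, AddHom.coe_mk]
      rw [dif_pos hkj]
    obtain ⟨z, hz, hz0, hz1⟩ := (isPreconnected_closed_iff.1 hCc) _ _ (hpart {0}) (hpart {0}ᶜ) hcov
      ⟨y, hy.1, (hmem _ _).2 ⟨0, Nat.zero_le _, hy, by rw [hy0]; exact hx00⟩⟩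
      ⟨x, hx.1, (hmem _ _).2 ⟨k, hkj'.1, hx, by
        rw [hval]; exact hc⟩⟩
    obtain ⟨k1, hk1, hs1, hv1⟩ := (hmem _ _).1 hz0
    obtain ⟨k2, hk2, hs2, hv2⟩ := (hmem _ _).1 hz1
    exact hv2 ((hall k1 hk1 z hs1 k2 hk2 hs2.2).trans hv1)

/-- Cartesian coordinates on a (Euclidean) plane. -/
structure Frame (E : Type*) [MetricSpace E] where
  h : E → ℝ
  ξ : E → ℝ
  pt : ℝ → ℝ → E
  h_pt : ∀ a b, h (pt a b) = a
  ξ_pt : ∀ a b, ξ (pt a b) = b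
  pt_h : ∀ x, pt (h x) (ξ x) = x
  dist_sq : ∀ x y, dist x y ^ 2 = (h x - h y) ^ 2 + (ξ x - ξ y) ^ 2

namespace Frame

variable {E : Type*} [MetricSpace E] (F : Frame E)

/-- Reversing the second coordinate. -/
def mirror : Frame E where
  h := F.h
  ξ := fun x => -F.ξ x
  pt := fun a b => F.pt a (-b)
  h_pt := fun a b => F.h_pt _ _
  ξ_pt := fun a b => by rw [F.ξ_pt, neg_neg]
  pt_h := fun x => by rw [neg_neg, F.pt_h]
  dist_sq := fun x y => by rw [F.dist_sq]; ring

theorem abs_h_sub_le (x y : E) : |F.h x - F.h y| ≤ dist x y := by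
  apply abs_le_of_sq_le_sq _ dist_nonneg
  rw [F.dist_sq]
  nlinarith [sq_nonneg (F.ξ x - F.ξ y)]

theorem abs_ξ_sub_le (x y : E) : |F.ξ x - F.ξ y| ≤ dist x y := by
  apply abs_le_of_sq_le_sq _ dist_nonneg
  rw [F.dist_sq]
  nlinarith [sq_nonneg (F.h x - F.h y)]

theorem continuous_h : Continuous F.h := by
  refine (LipschitzWith.of_dist_le_mul (K := 1) fun x y => ?_).continuous
  simpa [Real.dist_eq] using F.abs_h_sub_le x y

theorem continuous_ξ : Continuous F.ξ := by
  refine (LipschitzWith.of_dist_le_mul (K := 1) fun x y => ?_).continuous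
  simpa [Real.dist_eq] using F.abs_ξ_sub_le x y

theorem dist_pt (a b a' b' : ℝ) : dist (F.pt a b) (F.pt a' b') = √((a - a') ^ 2 + (b - b') ^ 2) := by
  rw [← Real.sqrt_sq (dist_nonneg (x := F.pt a b) (y := F.pt a' b')), F.dist_sq]
  simp only [F.h_pt, F.ξ_pt]

theorem dist_pt_left (a a' b : ℝ) : dist (F.pt a b) (F.pt a' b) = |a - a'| := by
  rw [dist_pt, sub_self, zero_pow two_ne_zero, add_zero, Real.sqrt_sq_eq_abs]

theorem dist_pt_right (a b b' : ℝ) : dist (F.pt a b) (F.pt a b') = |b - b'| := by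
  rw [dist_pt, sub_self, zero_pow two_ne_zero, zero_add, Real.sqrt_sq_eq_abs]

theorem continuous_pt_right (a : ℝ) : Continuous (F.pt a) := by
  refine (LipschitzWith.of_dist_le_mul (K := 1) fun x y => ?_).continuous
  rw [F.dist_pt_right, Real.dist_eq]
  simp

/-- Points of the horizontal line at height `y` where the distance to `C` equals `t` and exceeds
`t` immediately afterwards. -/
def riseSet (C : Set E) (t y : ℝ) : Set ℝ :=
  {x | infDist (F.pt y x) C = t ∧ ∀ᶠ η in nhdsWithin 0 (Set.Ioi 0), t < infDist (F.pt y (x + η)) C}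

/-- Points of the horizontal line at height `y` where the line enters `C`. -/
def entrySet (C : Set E) (y : ℝ) : Set ℝ :=
  {z | F.pt y z ∈ C ∧ ∀ᶠ η in nhdsWithin 0 (Set.Ioi 0), F.pt y (z - η) ∉ C}

theorem exists_mem_entrySet {C : Set E} (hC : IsClosed C) {y a b : ℝ} (hab : a < b)
    (ha : F.pt y a ∉ C) (hb : F.pt y b ∈ C) : ∃ z ∈ F.entrySet C y, a < z ∧ z ≤ b := by
  set S : Set ℝ := {u | a ≤ u ∧ F.pt y u ∈ C} with hS
  have hSc : IsClosed S :=
    isClosed_Ici.inter (hC.preimage (F.continuous_pt_right y))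
  have hbS : b ∈ S := ⟨hab.le, hb⟩
  have hbd : BddBelow S := ⟨a, fun u hu => hu.1⟩
  have hz : sInf S ∈ S := hSc.csInf_mem ⟨b, hbS⟩ hbd
  have haz : a < sInf S := lt_of_le_of_ne hz.1 fun hc => ha (hc ▸ hz.2)
  refine ⟨sInf S, ⟨hz.2, ?_⟩, haz, csInf_le hbd hbS⟩
  have : Set.Ioo 0 (sInf S - a) ∈ nhdsWithin (0 : ℝ) (Set.Ioi 0) :=
    Ioo_mem_nhdsGT (sub_pos.2 haz)
  filter_upwards [this] with η hη hc
  have := csInf_le hbd (show sInf S - η ∈ S from ⟨by linarith [hη.2], hc⟩)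
  linarith [hη.1]

theorem notMem_of_lt_infDist {C : Set E} {x y : E} {t : ℝ} (h : t < infDist x C)
    (hxy : dist x y ≤ t) : y ∉ C := fun hy =>
  absurd (infDist_le_dist_of_mem hy) (not_le.2 (hxy.trans_lt h))

variable [ProperSpace E]

theorem sum_card_rise_add_one_le {C : Set E} (hC : IsClosed C) (hCc : IsPreconnected C)
    {M : ℝ} (hCne : C.Nonempty) (hM : ∀ x ∉ C, |F.ξ x| < M) {t : ℝ} (ht : 0 < t)
    {l : ℕ → ℝ} (hl : ∀ k, l (k + 1) = l k + 2 * t) {m : ℕ} {P Z : ℕ → Finset ℝ}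
    (P0 : P 0 = ∅) (Pm : P m = ∅) (hP : ∀ k, ∀ p ∈ P k, p ∈ F.riseSet C t (l k + t))
    (hZ : ∀ k < m, F.entrySet C (l (k + 1)) ⊆ Z k)
    {k₀ : ℕ} (hk₀ : k₀ < m) {x₀ : ℝ} (hx₀ : F.pt (l (k₀ + 1)) x₀ ∉ C) :
    ∑ k ∈ Finset.range (m + 1), (P k).card + 1 ≤ ∑ k ∈ Finset.range m, (Z k).card := by
  classical
  have hmono : StrictMono l := strictMono_nat_of_lt_succ fun k => by rw [hl]; linarith
  have hη : ∀ᶠ η in nhdsWithin (0 : ℝ) (Set.Ioi 0), ∀ k ∈ Finset.range (m + 1), ∀ p ∈ P k,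
      t < infDist (F.pt (l k + t) (p + η)) C ∧ ∀ p' ∈ P k, p < p' → p + η < p' := by
    rw [Filter.eventually_all_finset]
    intro k _
    rw [Filter.eventually_all_finset]
    intro p hp
    refine (hP k p hp).2.and ?_
    rw [Filter.eventually_all_finset]
    intro p' _
    by_cases hpp : p < p'
    · have : Set.Ioo 0 (p' - p) ∈ nhdsWithin (0 : ℝ) (Set.Ioi 0) := Ioo_mem_nhdsGT (sub_pos.2 hpp)
      filter_upwards [this] with η hη _
      linarith [hη.2]
    · exact Eventually.of_forall fun η hc => absurd hc hpp
  obtain ⟨η, hη, hη0⟩ := (hη.and self_mem_nhdsWithin).exists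
  have hη0 : 0 < η := hη0
  have key := sum_card_add_one_le F.continuous_h F.continuous_ξ F.h_pt F.ξ_pt F.pt_h hC hCc hM
    hmono (m := m) (q := fun k => (P k).map (addRightEmbedding η)) (Z := Z) (by simp [P0])
    (by simp [Pm]) ?_ ?_ ?_ hk₀ hx₀
  · simpa using key
  · intro k _ hkm q hq y hy
    obtain ⟨p, hp, rfl⟩ := Finset.mem_map.1 hq
    have h1 := (hη k (by simp; omega) p hp).1
    refine notMem_of_lt_infDist h1 ?_
    rw [addRightEmbedding_apply, F.dist_pt_left, abs_le]
    rw [hl] at hy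
    constructor <;> linarith [hy.1, hy.2]
  · intro k _ hkm q hq q' hq' hqq
    obtain ⟨p, hp, rfl⟩ := Finset.mem_map.1 hq
    obtain ⟨p', hp', rfl⟩ := Finset.mem_map.1 hq'
    simp only [addRightEmbedding_apply, add_lt_add_iff_right] at hqq ⊢
    obtain ⟨h1, h2⟩ := hη k (by simp; omega) p hp
    have h3 := (hη k (by simp; omega) p' hp').1
    have h4 := h2 p' hp' hqq
    obtain ⟨z, hz, hzd⟩ := hC.exists_infDist_eq_dist hCne (F.pt (l k + t) p')
    rw [(hP k p' hp').1] at hzd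
    have habs := F.abs_h_sub_le (F.pt (l k + t) p') z
    rw [F.h_pt, ← hzd, abs_le] at habs
    have key : ∀ x, t < infDist (F.pt (l k + t) x) C → ¬ (ξ F z - x) ^ 2 ≤ (ξ F z - p') ^ 2 := by
      intro x hx hc
      refine notMem_of_lt_infDist hx ?_ hz
      apply le_of_sq_le_sq _ ht.le
      have e1 := F.dist_sq (F.pt (l k + t) p') z
      have e2 := F.dist_sq (F.pt (l k + t) x) z
      rw [← hzd] at e1
      simp only [F.h_pt, F.ξ_pt] at e1 e2
      nlinarith
    refine ⟨z, hz, ⟨by linarith, by rw [hl]; linarith⟩, ?_, ?_⟩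
    · by_contra hc
      exact key _ h1 (by nlinarith)
    · by_contra hc
      exact key _ h3 (by nlinarith)
  · intro k hk x y hxy hy hx
    obtain ⟨z, hz, h1, h2⟩ := F.exists_mem_entrySet hC hxy hx hy
    exact ⟨z, hZ k hk hz, h1, h2⟩

end Frame

/-- The number of elements of a set, as an extended nonnegative real. -/
def cnt {α : Type*} (S : Set α) : ENNReal := (S.encard : ENNReal)

theorem cnt_empty {α : Type*} : cnt (∅ : Set α) = 0 := by simp [cnt]

theorem cnt_mono {α : Type*} {S T : Set α} (h : S ⊆ T) : cnt S ≤ cnt T :=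
  ENat.toENNReal_mono (Set.encard_le_encard h)

theorem cnt_finset {α : Type*} (S : Finset α) : cnt (S : Set α) = S.card := by
  simp [cnt, Set.encard_coe_eq_coe_finsetCard]

theorem cnt_eq_top {α : Type*} {S : Set α} (h : S.Infinite) : cnt S = ⊤ := by
  simp [cnt, h]

/-- If every choice of finite subsets has bounded total size, so does the whole family. -/
theorem sum_cnt_le_of_finset {ι α : Type*} (s : Finset ι) (S : ι → Set α) (B : ENNReal)
    (h : ∀ P : ι → Finset α, (∀ i, (P i : Set α) ⊆ S i) → ∑ i ∈ s, ((P i).card : ENNReal) ≤ B) :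
    ∑ i ∈ s, cnt (S i) ≤ B := by
  classical
  by_cases hfin : ∀ i ∈ s, (S i).Finite
  · let P : ι → Finset α := fun i => if hi : (S i).Finite then hi.toFinset else ∅
    refine le_trans (le_of_eq (Finset.sum_congr rfl fun i hi => ?_)) (h P fun i => ?_)
    · simp only [P, dif_pos (hfin i hi), ← cnt_finset, Set.Finite.coe_toFinset]
    · by_cases hi : (S i).Finite <;> simp [P, hi]
  · push Not at hfin
    obtain ⟨i, hi, hinf⟩ := hfin
    have hB : B = ⊤ := by
      apply ENNReal.eq_top_of_forall_nnreal_le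
      intro r
      obtain ⟨n, hn⟩ := exists_nat_ge r
      obtain ⟨T, hT, hTc⟩ := Set.Infinite.exists_subset_card_eq hinf n
      refine le_trans ?_ (h (fun j => if j = i then T else ∅) fun j => ?_)
      · rw [Finset.sum_eq_single i (by intro j _ hj; simp [hj]) (fun hc => absurd hi hc)]
        simp only [if_true, hTc]
        exact_mod_cast hn
      · by_cases hj : j = i
        · subst hj; simpa using hT
        · simp [hj]
    rw [hB]
    exact le_top

namespace Frame

variable {E : Type*} [MetricSpace E] (F : Frame E)

theorem abs_lt_of_mem_riseSet {C : Set E} {M : ℝ} (hMh : ∀ x ∉ C, |F.h x| < M) {t y z : ℝ}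
    (ht : 0 < t) (hz : z ∈ F.riseSet C t y) : |y| < M := by
  obtain ⟨η, hη⟩ := hz.2.exists
  have : F.pt y (z + η) ∉ C := notMem_of_lt_infDist hη (by simpa using ht.le)
  simpa [F.h_pt] using hMh _ this

theorem tsum_cnt_rise_add_one_le [ProperSpace E] {C : Set E} (hC : IsClosed C)
    (hCc : IsPreconnected C) (hCne : C.Nonempty) {M : ℝ} (hM : ∀ x ∉ C, |F.ξ x| < M)
    (hMh : ∀ x ∉ C, |F.h x| < M) {t : ℝ} (ht : 0 < t) {w₀ : E} (hw₀ : t < infDist w₀ C) (c : ℝ) :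
    ∑' k : ℤ, cnt (F.riseSet C t (c + k * (2 * t) + t)) + 1 ≤
      ∑' k : ℤ, cnt (F.entrySet C (c + k * (2 * t))) := by
  classical
  have h2t : 0 < 2 * t := by linarith
  obtain ⟨N, hN⟩ := exists_nat_gt ((M + |c| + 2 * t) / (2 * t))
  rw [div_lt_iff₀ h2t] at hN
  have hc := abs_le.1 (le_refl |c|)
  set l : ℕ → ℝ := fun k => c + ((k : ℤ) - N : ℤ) * (2 * t) with hl_def
  have hl : ∀ k, l (k + 1) = l k + 2 * t := by
    intro k; simp only [hl_def]; push_cast; ring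
  have hmono : StrictMono l := strictMono_nat_of_lt_succ fun k => by rw [hl]; linarith
  have hl0 : l 0 + t < -M := by
    simp only [hl_def]; push_cast; nlinarith
  have hlm : M < l (2 * N) := by
    simp only [hl_def]; push_cast; nlinarith
  by_cases htop : ∑' k : ℤ, cnt (F.entrySet C (c + k * (2 * t))) = ⊤
  · rw [htop]; exact le_top
  have hZfin : ∀ k : ℤ, (F.entrySet C (c + k * (2 * t))).Finite := by
    intro k
    by_contra hinf
    exact ENNReal.ne_top_of_tsum_ne_top htop k (cnt_eq_top hinf)
  let Z : ℕ → Finset ℝ := fun k => (hZfin ((k + 1 : ℕ) - N : ℤ)).toFinset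
  have hZsum : ((∑ k ∈ Finset.range (2 * N), (Z k).card : ℕ) : ENNReal) ≤
      ∑' k : ℤ, cnt (F.entrySet C (c + k * (2 * t))) := by
    push_cast
    have hinj : Function.Injective fun k : ℕ => (((k + 1 : ℕ) : ℤ) - N) := by
      intro a b hab; simp only at hab; omega
    refine le_trans ?_ (ENNReal.sum_le_tsum ((Finset.range (2 * N)).map ⟨_, hinj⟩))
    rw [Finset.sum_map]
    refine le_of_eq (Finset.sum_congr rfl fun k _ => ?_)
    rw [← cnt_finset]
    simp only [Z, Set.Finite.coe_toFinset, Function.Embedding.coeFn_mk]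
  -- a level hitting the complement of `C`
  obtain ⟨k₀, hk₀, hx₀⟩ : ∃ k₀ < 2 * N, F.pt (l (k₀ + 1)) (F.ξ w₀) ∉ C := by
    set K : ℤ := round ((F.h w₀ - c) / (2 * t)) with hK
    have hr := abs_sub_round ((F.h w₀ - c) / (2 * t))
    have hlev : |F.h w₀ - (c + K * (2 * t))| ≤ t := by
      have e : F.h w₀ - (c + K * (2 * t)) = ((F.h w₀ - c) / (2 * t) - K) * (2 * t) := by
        field_simp; ring
      rw [e, abs_mul, abs_of_pos h2t]
      nlinarith
    have hnot : F.pt (c + K * (2 * t)) (F.ξ w₀) ∉ C := by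
      refine notMem_of_lt_infDist hw₀ ?_
      conv_lhs => rw [← F.pt_h w₀]
      rw [F.ξ_pt, F.dist_pt_left]
      exact hlev
    have hb := hMh _ hnot
    rw [F.h_pt, abs_lt] at hb
    have hK1 : (-(N : ℝ)) < K := by
      simp only [hl_def] at hl0; push_cast at hl0
      nlinarith
    have hK2 : (K : ℝ) < N := by
      simp only [hl_def] at hlm; push_cast at hlm
      nlinarith
    have hK1' : -(N : ℤ) < K := by exact_mod_cast hK1
    have hK2' : K < N := by exact_mod_cast hK2
    refine ⟨(K + N - 1).toNat, by omega, ?_⟩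
    have : l ((K + N - 1).toNat + 1) = c + K * (2 * t) := by
      simp only [hl_def]
      have : (((K + N - 1).toNat + 1 : ℕ) : ℤ) - N = K := by
        push_cast; rw [Int.toNat_of_nonneg (by omega)]; ring
      rw [this]
    rw [this]
    exact hnot
  have hPsum : ∑' k : ℤ, cnt (F.riseSet C t (c + k * (2 * t) + t)) =
      ∑ k ∈ Finset.range (2 * N + 1), cnt (F.riseSet C t (l k + t)) := by
    have hinj : Function.Injective fun k : ℕ => ((k : ℤ) - N) := by
      intro a b hab; simp only at hab; omega
    rw [tsum_eq_sum (s := (Finset.range (2 * N + 1)).map ⟨_, hinj⟩), Finset.sum_map]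
    · rfl
    · intro K hK
      have hempty : F.riseSet C t (c + K * (2 * t) + t) = ∅ := by
        rw [Set.eq_empty_iff_forall_notMem]
        intro z hz
        have hb := F.abs_lt_of_mem_riseSet hMh ht hz
        rw [abs_lt] at hb
        apply hK
        have hK1 : (-(N : ℝ)) < K := by
          simp only [hl_def] at hl0; push_cast at hl0
          nlinarith
        have hK2 : (K : ℝ) < N := by
          simp only [hl_def] at hlm; push_cast at hlm
          nlinarith
        have hK1' : -(N : ℤ) < K := by exact_mod_cast hK1
        have hK2' : K < N := by exact_mod_cast hK2
        simp only [Finset.mem_map, Finset.mem_range, Function.Embedding.coeFn_mk]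
        exact ⟨(K + N).toNat, by omega, by omega⟩
      rw [hempty, cnt_empty]
  rw [hPsum]
  have hS0 : F.riseSet C t (l 0 + t) = ∅ := by
    rw [Set.eq_empty_iff_forall_notMem]
    intro z hz
    have hb := abs_lt.1 (F.abs_lt_of_mem_riseSet hMh ht hz)
    linarith
  have hSm : F.riseSet C t (l (2 * N) + t) = ∅ := by
    rw [Set.eq_empty_iff_forall_notMem]
    intro z hz
    have hb := abs_lt.1 (F.abs_lt_of_mem_riseSet hMh ht hz)
    linarith
  have hmain : ∀ P : ℕ → Finset ℝ, (∀ k, (P k : Set ℝ) ⊆ F.riseSet C t (l k + t)) →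
      ∑ k ∈ Finset.range (2 * N + 1), (P k).card + 1 ≤ ∑ k ∈ Finset.range (2 * N), (Z k).card := by
    intro P hP
    refine F.sum_card_rise_add_one_le hC hCc hCne hM ht hl ?_ ?_ (fun k p hp => hP k hp) ?_ hk₀ hx₀
    · simpa [hS0] using hP 0
    · simpa [hSm] using hP (2 * N)
    · intro k _
      simp [Z, hl_def]
  set B := ∑ k ∈ Finset.range (2 * N), (Z k).card with hB
  have hB1 : 1 ≤ B := le_trans (by omega) (hmain (fun _ => ∅) (by simp))
  have h1 : ∑ k ∈ Finset.range (2 * N + 1), cnt (F.riseSet C t (l k + t)) ≤ ((B - 1 : ℕ) : ENNReal) := by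
    apply sum_cnt_le_of_finset
    intro P hP
    have := hmain P hP
    have h2 : ∑ k ∈ Finset.range (2 * N + 1), (P k).card ≤ B - 1 := by omega
    exact_mod_cast h2
  calc _ ≤ ((B - 1 : ℕ) : ENNReal) + 1 := by gcongr
    _ = (B : ENNReal) := by
      have : B = (B - 1) + 1 := by omega
      conv_rhs => rw [this]
      push_cast; rfl
    _ ≤ _ := hZsum

end Frame

theorem lintegral_eq_lintegral_tsum_period {g : ℝ → ENNReal} (hg : AEMeasurable g) {T : ℝ}
    (hT : 0 < T) : ∫⁻ c, g c = ∫⁻ c in Set.Ioc 0 T, ∑' k : ℤ, g (c + k * T) := by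
  have hmp : ∀ k : ℤ, MeasurePreserving (fun c : ℝ => c + k * T) volume volume :=
    fun k => measurePreserving_add_right volume _
  rw [lintegral_tsum]
  · rw [← setLIntegral_univ, ← iUnion_Ioc_add_zsmul hT 0, lintegral_iUnion
      (fun _ => measurableSet_Ioc) (Set.pairwise_disjoint_Ioc_add_zsmul 0 T)]
    congr 1
    ext k
    have hpre : (fun c : ℝ => c + k * T) ⁻¹' (Set.Ioc (0 + k • T) (0 + (k + 1) • T)) =
        Set.Ioc 0 T := by
      ext c
      simp only [Set.mem_preimage, Set.mem_Ioc, zsmul_eq_mul]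
      push_cast
      constructor <;> rintro ⟨h1, h2⟩ <;> constructor <;> linarith
    rw [← hpre]
    exact ((hmp k).setLIntegral_comp_preimage_emb
      (MeasurableEquiv.addRight ((k : ℝ) * T)).measurableEmbedding g _).symm
  · intro k
    exact (hg.comp_quasiMeasurePreserving (hmp k).quasiMeasurePreserving).restrict

namespace Frame

variable {E : Type*} [MetricSpace E] (F : Frame E)

/-- Transversal crossing counts on almost every horizontal line integrate to the directional
inequality. -/
theorem lintegral_rise_add_le [ProperSpace E] {C : Set E} (hC : IsClosed C)
    (hCc : IsPreconnected C) (hCne : C.Nonempty) {M : ℝ} (hM : ∀ x ∉ C, |F.ξ x| < M)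
    (hMh : ∀ x ∉ C, |F.h x| < M) {t : ℝ} (ht : 0 < t) {w₀ : E} (hw₀ : t < infDist w₀ C)
    {g₁ g₂ : ℝ → ENNReal} (hg₁ : AEMeasurable g₁) (hg₂ : AEMeasurable g₂)
    (h₁ : ∀ᵐ y, g₁ y ≤ cnt (F.riseSet C t y) + cnt (F.mirror.riseSet C t y))
    (h₂ : ∀ᵐ y, cnt (F.entrySet C y) + cnt (F.mirror.entrySet C y) ≤ g₂ y) :
    (∫⁻ y, g₁ y) + 4 * ENNReal.ofReal t ≤ ∫⁻ y, g₂ y := by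
  have h2t : 0 < 2 * t := by linarith
  have hshift : ∀ {p : ℝ → Prop}, (∀ᵐ y, p y) → ∀ s : ℝ, ∀ᵐ y, p (y + s) := fun hp s =>
    (measurePreserving_add_right volume s).quasiMeasurePreserving.ae hp
  have e1 : ∫⁻ y, g₁ y = ∫⁻ y, g₁ (y + t) := (lintegral_add_right_eq_self g₁ t).symm
  have hg₁' : AEMeasurable fun y => g₁ (y + t) := hg₁.comp_quasiMeasurePreserving
    (measurePreserving_add_right volume t).quasiMeasurePreserving
  rw [e1, lintegral_eq_lintegral_tsum_period hg₁' h2t, lintegral_eq_lintegral_tsum_period hg₂ h2t]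
  have h4 : 4 * ENNReal.ofReal t = ∫⁻ _ in Set.Ioc 0 (2 * t), 2 := by
    rw [setLIntegral_const, Real.volume_Ioc, sub_zero, ENNReal.ofReal_mul (by norm_num), ← mul_assoc]
    norm_num
  rw [h4, ← lintegral_add_right _ measurable_const]
  apply lintegral_mono_ae
  apply ae_restrict_of_ae
  have a1 : ∀ᵐ c, ∀ k : ℤ, g₁ (c + k * (2 * t) + t) ≤ cnt (F.riseSet C t (c + k * (2 * t) + t)) +
      cnt (F.mirror.riseSet C t (c + k * (2 * t) + t)) := by
    rw [ae_all_iff]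
    intro k
    exact hshift (p := fun y => g₁ (y + t) ≤ cnt (F.riseSet C t (y + t)) +
      cnt (F.mirror.riseSet C t (y + t))) (hshift h₁ t) _
  have a2 : ∀ᵐ c, ∀ k : ℤ, cnt (F.entrySet C (c + k * (2 * t))) +
      cnt (F.mirror.entrySet C (c + k * (2 * t))) ≤ g₂ (c + k * (2 * t)) := by
    rw [ae_all_iff]
    intro k
    exact hshift h₂ _
  filter_upwards [a1, a2] with c ha1 ha2
  have b1 := F.tsum_cnt_rise_add_one_le hC hCc hCne hM hMh ht hw₀ c
  have b2 := F.mirror.tsum_cnt_rise_add_one_le hC hCc hCne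
    (fun x hx => by simpa [mirror] using hM x hx) hMh ht hw₀ c
  calc _ ≤ ∑' k : ℤ, (cnt (F.riseSet C t (c + k * (2 * t) + t)) +
      cnt (F.mirror.riseSet C t (c + k * (2 * t) + t))) + 2 := by
        gcongr with k; exact ha1 k
    _ = (∑' k : ℤ, cnt (F.riseSet C t (c + k * (2 * t) + t)) + 1) +
        (∑' k : ℤ, cnt (F.mirror.riseSet C t (c + k * (2 * t) + t)) + 1) := by
        rw [ENNReal.tsum_add, ← one_add_one_eq_two]; ring
    _ ≤ _ := by
        refine (add_le_add b1 b2).trans ?_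
        rw [← ENNReal.tsum_add]
        exact ENNReal.tsum_le_tsum ha2

end Frame

/-- A measurable set covered by neighbourhoods of its points splits into countably many disjoint
measurable pieces, each inside one of the neighbourhoods. -/
theorem exists_disjoint_measurable_cover {X : Type*} [TopologicalSpace X]
    [SecondCountableTopology X] [MeasurableSpace X] [OpensMeasurableSpace X] {S : Set X}
    (hS : MeasurableSet S) (p : Set X → Prop) (hp0 : p ∅) (hp : ∀ A B, A ⊆ B → p B → p A)
    (hU : ∀ x ∈ S, ∃ U ∈ nhds x, p U) :
    ∃ A : ℕ → Set X, (∀ n, MeasurableSet (A n)) ∧ Pairwise (Function.onFun Disjoint A) ∧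
      ⋃ n, A n = S ∧ ∀ n, p (A n) := by
  classical
  rcases S.eq_empty_or_nonempty with rfl | hne
  · exact ⟨fun _ => ∅, by simp, fun i j _ => by simp [Function.onFun], by simp, fun _ => hp0⟩
  have hU' : ∀ x, ∃ U : Set X, x ∈ S → IsOpen U ∧ x ∈ U ∧ p U := by
    intro x
    by_cases hx : x ∈ S
    · obtain ⟨U, hU1, hU2⟩ := hU x hx
      obtain ⟨V, hVU, hV, hxV⟩ := mem_nhds_iff.1 hU1
      exact ⟨V, fun _ => ⟨hV, hxV, hp _ _ hVU hU2⟩⟩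
    · exact ⟨∅, fun h => absurd h hx⟩
  choose U hU using hU'
  obtain ⟨T, hTS, hTc, hcov⟩ := TopologicalSpace.countable_cover_nhdsWithin (s := S) (f := U)
    fun x hx => mem_nhdsWithin_of_mem_nhds ((hU x hx).1.mem_nhds (hU x hx).2.1)
  have hTne : T.Nonempty := by
    obtain ⟨x, hx⟩ := hne
    obtain ⟨y, hy, -⟩ := Set.mem_iUnion₂.1 (hcov hx)
    exact ⟨y, hy⟩
  obtain ⟨e, he⟩ := hTc.exists_eq_range hTne
  have heS : ∀ n, e n ∈ S := fun n => hTS (he ▸ Set.mem_range_self n)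
  refine ⟨fun n => S ∩ disjointed (fun k => U (e k)) n, fun n => hS.inter ?_, ?_, ?_, fun n => ?_⟩
  · exact MeasurableSet.disjointed (fun k => (hU _ (heS k)).1.measurableSet) n
  · intro i j hij
    exact (disjoint_disjointed (fun k => U (e k)) hij).mono Set.inter_subset_right
      Set.inter_subset_right
  · rw [← Set.inter_iUnion, iUnion_disjointed, Set.inter_eq_left]
    intro x hx
    obtain ⟨y, hy, hxy⟩ := Set.mem_iUnion₂.1 (hcov hx)
    rw [he] at hy
    obtain ⟨k, rfl⟩ := hy
    exact Set.mem_iUnion.2 ⟨k, hxy⟩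
  · exact hp _ _ (Set.inter_subset_right.trans (disjointed_subset _ n)) (hU _ (heS n)).2.2

/-- `f` expands the length of subsets of `A` by nearly its speed. -/
def NearSpeed {V : Type*} [NormedAddCommGroup V] [MeasurableSpace V]
    [BorelSpace V]
    (f f' : ℝ → V) (ε : NNReal) (A : Set ℝ) : Prop :=
  ∀ B ⊆ A, MeasurableSet B → μH[1] (f '' B) ≤ (∫⁻ s in B, ‖f' s‖ₑ) + 2 * ε * volume B ∧
    ∫⁻ s in B, ‖f' s‖ₑ ≤ μH[1] (f '' B) + 2 * ε * volume B

theorem exists_nearSpeed {V : Type*} [NormedAddCommGroup V] [NormedSpace ℝ V] [MeasurableSpace V]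
    [BorelSpace V]
    {f f' : ℝ → V} (hf : ∀ s, HasDerivAt f (f' s) s) (hf' : Continuous f')
    {ε : NNReal} (hε : 0 < ε) (x : ℝ) : ∃ U ∈ nhds x, NearSpeed f f' ε U := by
  have hs : HasStrictDerivAt f (f' x) x :=
    hasStrictDerivAt_of_hasDerivAt_of_continuousAt (Eventually.of_forall hf) hf'.continuousAt
  obtain ⟨U, hUn, hU⟩ := hs.hasStrictFDerivAt.approximates_deriv_on_nhds (c := ε) (Or.inr hε)
  have hε' : (0 : ℝ) < ε := hε
  have hU2 : ∀ᶠ s in nhds x, dist (f' s) (f' x) < ε :=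
    hf'.continuousAt.eventually (ball_mem_nhds _ hε')
  refine ⟨U ∩ {s | dist (f' s) (f' x) < ε}, inter_mem hUn hU2, fun B hB hBm => ?_⟩
  have hkey : ∀ a ∈ B, ∀ b ∈ B, ‖f a - f b - (a - b) • f' x‖ ≤ ε * |a - b| := by
    intro a ha b hb
    simpa using hU a (hB ha).1 b (hB hb).1
  have hlow : ∀ s ∈ B, ‖f' s‖ₑ ≤ ‖f' x‖ₑ + ε := by
    intro s hs'
    have := (hB hs').2
    simp only [Set.mem_ofPred_eq, dist_eq_norm] at this
    have h2 : ‖f' s‖ ≤ ‖f' x‖ + ε := by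
      have := norm_le_insert' (f' s) (f' x)
      linarith
    have : ‖f' s‖₊ ≤ ‖f' x‖₊ + ε := h2
    simp only [enorm_eq_nnnorm]
    exact_mod_cast this
  have hhigh : ∀ s ∈ B, ‖f' x‖ₑ ≤ ‖f' s‖ₑ + ε := by
    intro s hs'
    have := (hB hs').2
    simp only [Set.mem_ofPred_eq, dist_eq_norm'] at this
    have h2 : ‖f' x‖ ≤ ‖f' s‖ + ε := by
      have := norm_le_insert' (f' x) (f' s)
      linarith
    have : ‖f' x‖₊ ≤ ‖f' s‖₊ + ε := h2
    simp only [enorm_eq_nnnorm]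
    exact_mod_cast this
  constructor
  · have hLip : LipschitzOnWith (‖f' x‖₊ + ε) f B := by
      apply LipschitzOnWith.of_dist_le_mul
      intro a ha b hb
      have := hkey a ha b hb
      rw [dist_eq_norm, Real.dist_eq]
      push_cast
      have h3 := norm_le_insert' (f a - f b) ((a - b) • f' x)
      rw [norm_smul, Real.norm_eq_abs] at h3
      linarith
    have h4 := hLip.hausdorffMeasure_image_le (d := 1) zero_le_one
    rw [hausdorffMeasure_real, ENNReal.rpow_one] at h4
    refine h4.trans ?_
    have h5 : ‖f' x‖ₑ * volume B ≤ (∫⁻ s in B, ‖f' s‖ₑ) + ε * volume B := by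
      rw [← setLIntegral_const, ← setLIntegral_const, ← lintegral_add_right _ measurable_const]
      exact setLIntegral_mono' hBm hhigh
    push_cast
    calc _ = ‖f' x‖ₑ * volume B + ε * volume B := by rw [← add_mul]; rfl
      _ ≤ (∫⁻ s in B, ‖f' s‖ₑ) + ε * volume B + ε * volume B := by gcongr
      _ = _ := by ring
  · have h5 : ∫⁻ s in B, ‖f' s‖ₑ ≤ ‖f' x‖ₑ * volume B + ε * volume B := by
      rw [← setLIntegral_const, ← setLIntegral_const, ← lintegral_add_right _ measurable_const]
      exact setLIntegral_mono' hBm hlow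
    rcases le_or_gt ‖f' x‖₊ ε with hle | hgt
    · refine h5.trans ?_
      have : ‖f' x‖ₑ ≤ ε := by simpa [enorm_eq_nnnorm] using hle
      calc _ ≤ ε * volume B + ε * volume B := by gcongr
        _ = 2 * ε * volume B := by ring
        _ ≤ _ := le_add_self
    · set K : NNReal := ‖f' x‖₊ - ε with hK
      have hK0 : 0 < K := tsub_pos_of_lt hgt
      have hKr : (K : ℝ) = ‖f' x‖ - ε := by rw [hK, NNReal.coe_sub hgt.le]; rfl
      have hanti : ∀ a ∈ B, ∀ b ∈ B, K * dist a b ≤ dist (f a) (f b) := by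
        intro a ha b hb
        have := hkey a ha b hb
        rw [dist_eq_norm (f a), Real.dist_eq, hKr]
        have h3 := norm_le_insert (f a - f b) ((a - b) • f' x)
        rw [norm_smul, Real.norm_eq_abs] at h3
        linarith
      have hinj : Set.InjOn f B := by
        intro a ha b hb hab
        have := hanti a ha b hb
        rw [hab, dist_self] at this
        have hK0' : (0 : ℝ) < K := hK0
        have h6 : dist a b ≤ 0 := by
          by_contra hc
          push Not at hc
          nlinarith
        exact dist_le_zero.1 h6
      have hinv : LipschitzOnWith K⁻¹ (Function.invFunOn f B) (f '' B) := by
        apply LipschitzOnWith.of_dist_le_mul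
        rintro _ ⟨a, ha, rfl⟩ _ ⟨b, hb, rfl⟩
        rw [hinj.leftInvOn_invFunOn ha, hinj.leftInvOn_invFunOn hb, NNReal.coe_inv,
          le_inv_mul_iff₀ (by exact_mod_cast hK0)]
        exact hanti a ha b hb
      have h4 := hinv.hausdorffMeasure_image_le (d := 1) zero_le_one
      rw [hinj.invFunOn_image le_rfl, hausdorffMeasure_real, ENNReal.rpow_one,
        ENNReal.coe_inv hK0.ne', ← ENNReal.div_eq_inv_mul,
        ENNReal.le_div_iff_mul_le (Or.inl (by exact_mod_cast hK0.ne')) (Or.inl (by simp))] at h4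
      have h7 : ‖f' x‖ₑ = K + ε := by
        rw [enorm_eq_nnnorm, hK]
        exact_mod_cast (tsub_add_cancel_of_le hgt.le).symm
      calc _ ≤ _ := h5
        _ = volume B * K + 2 * ε * volume B := by rw [h7]; ring
        _ ≤ _ := by gcongr

theorem NearSpeed.mono {V : Type*} [NormedAddCommGroup V] [MeasurableSpace V]
    [BorelSpace V]
    {f f' : ℝ → V} {ε : NNReal} {A B : Set ℝ} (hAB : A ⊆ B)
    (h : NearSpeed f f' ε B) : NearSpeed f f' ε A := fun D hD => h D (hD.trans hAB)

theorem exists_cover_nearSpeed {V : Type*} [NormedAddCommGroup V] [NormedSpace ℝ V] [MeasurableSpace V]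
    [BorelSpace V]
    {f f' : ℝ → V} (hf : ∀ s, HasDerivAt f (f' s) s)
    (hf' : Continuous f') {ε : NNReal} (hε : 0 < ε) {S : Set ℝ} (hS : MeasurableSet S) :
    ∃ A : ℕ → Set ℝ, (∀ n, MeasurableSet (A n)) ∧ Pairwise (Function.onFun Disjoint A) ∧
      ⋃ n, A n = S ∧ ∀ n, NearSpeed f f' ε (A n) := by
  apply exists_disjoint_measurable_cover hS
  · intro B hB
    rw [Set.subset_empty_iff] at hB
    simp [hB]
  · exact fun A B hAB h => h.mono hAB
  · exact fun x _ => exists_nearSpeed hf hf' hε x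

theorem le_of_forall_le_add_mul {a b v : ENNReal} (hv : v ≠ ⊤)
    (h : ∀ ε : NNReal, 0 < ε → a ≤ b + 2 * ε * v) : a ≤ b := by
  apply ENNReal.le_of_forall_pos_le_add
  intro δ hδ _
  lift v to NNReal using hv
  refine (h (δ / (2 * (v + 1))) (by positivity)).trans ?_
  gcongr
  have : 2 * (δ / (2 * (v + 1))) * v ≤ δ := by
    rw [← NNReal.coe_le_coe]
    push_cast
    have hv0 := v.coe_nonneg
    have hd0 := δ.coe_nonneg
    rw [mul_div_assoc', div_mul_eq_mul_div, div_le_iff₀ (by positivity)]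
    nlinarith
  exact_mod_cast this

/-- The length of a `C¹` image is at most the integral of the speed. -/
theorem hausdorffMeasure_image_le_lintegral {V : Type*} [NormedAddCommGroup V] [NormedSpace ℝ V] [MeasurableSpace V]
    [BorelSpace V]
    {f f' : ℝ → V} (hf : ∀ s, HasDerivAt f (f' s) s)
    (hf' : Continuous f') {S : Set ℝ} (hS : MeasurableSet S) (hfin : volume S ≠ ⊤) :
    μH[1] (f '' S) ≤ ∫⁻ s in S, ‖f' s‖ₑ := by
  apply le_of_forall_le_add_mul hfin
  intro ε hε
  obtain ⟨A, hA, hd, rfl, hp⟩ := exists_cover_nearSpeed hf hf' hε hS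
  rw [Set.image_iUnion, lintegral_iUnion hA hd, measure_iUnion hd hA, ← ENNReal.tsum_mul_left,
    ← ENNReal.tsum_add]
  exact (measure_iUnion_le _).trans (ENNReal.tsum_le_tsum fun n => (hp n _ le_rfl (hA n)).1)

/-- For an injective `C¹` curve the integral of the speed is at most the length of the image. -/
theorem lintegral_le_hausdorffMeasure_image {V : Type*} [NormedAddCommGroup V] [NormedSpace ℝ V] [MeasurableSpace V]
    [BorelSpace V]
    [SecondCountableTopology V] {f f' : ℝ → V}
    (hf : ∀ s, HasDerivAt f (f' s) s)
    (hf' : Continuous f') {S : Set ℝ} (hS : MeasurableSet S) (hfin : volume S ≠ ⊤)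
    (hinj : Set.InjOn f S) : ∫⁻ s in S, ‖f' s‖ₑ ≤ μH[1] (f '' S) := by
  have hfc : Continuous f := continuous_iff_continuousAt.2 fun s => (hf s).continuousAt
  apply le_of_forall_le_add_mul hfin
  intro ε hε
  obtain ⟨A, hA, hd, rfl, hp⟩ := exists_cover_nearSpeed hf hf' hε hS
  have hinjn : ∀ n, Set.InjOn f (A n) := fun n => hinj.mono (Set.subset_iUnion A n)
  rw [Set.image_iUnion, lintegral_iUnion hA hd, measure_iUnion hd hA, ← ENNReal.tsum_mul_left,
    measure_iUnion _ fun n => (hA n).image_of_continuousOn_injOn hfc.continuousOn (hinjn n),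
    ← ENNReal.tsum_add]
  · exact ENNReal.tsum_le_tsum fun n => (hp n _ le_rfl (hA n)).2
  · intro i j hij
    apply Set.disjoint_image_image
    intro a ha b hb hab
    rw [hinj (Set.mem_iUnion_of_mem i ha) (Set.mem_iUnion_of_mem j hb) hab] at ha
    exact Set.disjoint_left.1 (hd hij) ha hb

theorem count_eq_cnt {S : Set ℝ} (hS : MeasurableSet S) : Measure.count S = cnt S :=
  Measure.count_apply hS

theorem exists_injOn_nhds {f f' : ℝ → ℝ} (hf : ∀ s, HasDerivAt f (f' s) s) (hf' : Continuous f')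
    {x : ℝ} (hx : f' x ≠ 0) : ∃ U ∈ nhds x, Set.InjOn f U := by
  have hs : HasStrictDerivAt f (f' x) x :=
    hasStrictDerivAt_of_hasDerivAt_of_continuousAt (Eventually.of_forall hf) hf'.continuousAt
  have hpos : 0 < ‖f' x‖₊ / 2 := by simpa using hx
  obtain ⟨U, hUn, hU⟩ := hs.hasStrictFDerivAt.approximates_deriv_on_nhds (Or.inr hpos)
  refine ⟨U, hUn, fun a ha b hb hab => ?_⟩
  have h := hU a ha b hb
  rw [hab, sub_self] at h
  simp only [ContinuousLinearMap.toSpanSingleton_apply, smul_eq_mul, zero_sub, norm_neg, norm_mul,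
    NNReal.coe_div, coe_nnnorm, NNReal.coe_ofNat, Real.norm_eq_abs] at h
  have h1 : 0 < |f' x| := abs_pos.2 hx
  have h2 : |a - b| ≤ 0 := by
    by_contra hc
    push Not at hc
    nlinarith
  exact sub_eq_zero.1 (abs_nonpos_iff.1 h2)

/-- The Banach indicatrix formula for a `C¹` function, counting noncritical preimages. -/
theorem lintegral_cnt_fiber {f f' : ℝ → ℝ} (hf : ∀ s, HasDerivAt f (f' s) s) (hf' : Continuous f')
    {S : Set ℝ} (hS : MeasurableSet S) :
    Measurable (fun c => cnt {s ∈ S | f s = c ∧ f' s ≠ 0}) ∧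
      ∫⁻ c, cnt {s ∈ S | f s = c ∧ f' s ≠ 0} = ∫⁻ s in S, ‖f' s‖ₑ := by
  have hfc : Continuous f := continuous_iff_continuousAt.2 fun s => (hf s).continuousAt
  have hN : MeasurableSet {s | f' s ≠ 0} := (isOpen_ne_fun hf' continuous_const).measurableSet
  obtain ⟨A, hA, hd, hU, hinj⟩ := exists_disjoint_measurable_cover (hS.inter hN)
    (fun A => Set.InjOn f A) (by simp) (fun A B hAB h => h.mono hAB)
    (fun x hx => exists_injOn_nhds hf hf' hx.2)
  have him : ∀ n, MeasurableSet (f '' A n) := fun n =>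
    (hA n).image_of_continuousOn_injOn hfc.continuousOn (hinj n)
  have hcnt : ∀ c, cnt {s ∈ S | f s = c ∧ f' s ≠ 0} =
      ∑' n, (f '' A n).indicator (fun _ => (1 : ENNReal)) c := by
    intro c
    have hset : {s ∈ S | f s = c ∧ f' s ≠ 0} = ⋃ n, (A n ∩ f ⁻¹' {c}) := by
      rw [← Set.iUnion_inter, hU]
      ext s
      simp only [Set.mem_ofPred_eq, Set.mem_inter_iff, Set.mem_preimage, Set.mem_singleton_iff]
      tauto
    have hm : ∀ n, MeasurableSet (A n ∩ f ⁻¹' {c}) := fun n =>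
      (hA n).inter (hfc.measurable (measurableSet_singleton c))
    rw [hset, ← count_eq_cnt (MeasurableSet.iUnion hm), measure_iUnion _ hm]
    · congr 1
      ext n
      rw [count_eq_cnt (hm n)]
      by_cases hc : c ∈ f '' A n
      · obtain ⟨s, hs, rfl⟩ := hc
        rw [Set.indicator_of_mem (Set.mem_image_of_mem f hs)]
        have : A n ∩ f ⁻¹' {f s} = {s} := by
          ext u
          simp only [Set.mem_inter_iff, Set.mem_preimage, Set.mem_singleton_iff]
          exact ⟨fun h => hinj n h.1 hs h.2, fun h => by rw [h]; exact ⟨hs, rfl⟩⟩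
        rw [this]
        simp [cnt]
      · rw [Set.indicator_of_notMem hc]
        have : A n ∩ f ⁻¹' {c} = ∅ := by
          rw [Set.eq_empty_iff_forall_notMem]
          rintro u ⟨hu, hu'⟩
          exact hc ⟨u, hu, hu'⟩
        rw [this, cnt_empty]
    · intro i j hij
      exact (hd hij).mono Set.inter_subset_left Set.inter_subset_left
  have hmeas : ∀ n, Measurable ((f '' A n).indicator (fun _ => (1 : ENNReal))) := fun n =>
    measurable_const.indicator (him n)
  simp only [hcnt]
  refine ⟨Measurable.tsum hmeas, ?_⟩
  rw [lintegral_tsum fun n => (hmeas n).aemeasurable]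
  have h1 : ∀ n, ∫⁻ c, (f '' A n).indicator (fun _ => (1 : ENNReal)) c = ∫⁻ s in A n, ‖f' s‖ₑ := by
    intro n
    rw [lintegral_indicator (him n), lintegral_image_eq_lintegral_abs_deriv_mul (hA n)
      (fun x _ => (hf x).hasDerivWithinAt) (hinj n)]
    simp [Real.enorm_eq_ofReal_abs]
  simp only [h1]
  rw [← lintegral_iUnion hA hd, hU, ← lintegral_indicator (hS.inter hN), ← lintegral_indicator hS]
  congr 1
  ext s
  by_cases hs : s ∈ S <;> by_cases hs' : f' s = 0 <;> simp [Set.indicator, hs, hs']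

/-- One-dimensional Sard: almost every value is regular. -/
theorem ae_regular_value {f f' : ℝ → ℝ} (hf : ∀ s, HasDerivAt f (f' s) s) (hf' : Continuous f') :
    ∀ᵐ c, ∀ s ∈ Set.Ico (0 : ℝ) 1, f s = c → f' s ≠ 0 := by
  have hS : MeasurableSet (Set.Ico (0 : ℝ) 1 ∩ {s | f' s = 0}) :=
    measurableSet_Ico.inter (isClosed_eq hf' continuous_const).measurableSet
  have h := hausdorffMeasure_image_le_lintegral hf hf' hS
    (ne_top_of_le_ne_top (by simp) (measure_mono Set.inter_subset_left))
  rw [setLIntegral_congr_fun (g := fun _ => 0) hS (fun s hs => by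
    have : f' s = 0 := hs.2
    simp [this]), lintegral_zero, nonpos_iff_eq_zero, hausdorffMeasure_real] at h
  rw [ae_iff]
  refine measure_mono_null ?_ h
  intro c hc
  simp only [Set.mem_ofPred_eq] at hc
  push Not at hc
  obtain ⟨s, hs, h1, h2⟩ := hc
  exact ⟨s, ⟨hs, h2⟩, h1⟩

theorem integral_abs_cos_period : ∫ θ in (0 : ℝ)..(2 * π), |cos θ| = 4 := by
  have hi : ∀ a b : ℝ, IntervalIntegrable (fun θ => |cos θ|) volume a b := fun a b =>
    (continuous_cos.abs).intervalIntegrable a b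
  have hper : Function.Periodic (fun θ : ℝ => |cos θ|) (2 * π) := fun θ => by
    simp only [cos_add_two_pi]
  have h := hper.intervalIntegral_add_eq 0 (-(π / 2))
  rw [zero_add] at h
  rw [h, ← intervalIntegral.integral_add_adjacent_intervals (hi _ (π / 2)) (hi _ _)]
  have h1 : ∫ θ in -(π / 2)..(π / 2), |cos θ| = 2 := by
    rw [intervalIntegral.integral_congr (g := cos)]
    · rw [integral_cos]; simp; norm_num
    · intro θ hθ
      rw [Set.uIcc_of_le (by linarith [pi_pos])] at hθ
      exact abs_of_nonneg (cos_nonneg_of_mem_Icc hθ)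
  have h2 : ∫ θ in (π / 2)..(-(π / 2) + 2 * π), |cos θ| = 2 := by
    rw [intervalIntegral.integral_congr (g := fun θ => -cos θ)]
    · rw [intervalIntegral.integral_neg, integral_cos]
      have : -(π / 2) + 2 * π = π / 2 + π := by ring
      rw [this, sin_add_pi]; simp; norm_num
    · intro θ hθ
      rw [Set.uIcc_of_le (by linarith [pi_pos])] at hθ
      exact abs_of_nonpos (cos_nonpos_of_pi_div_two_le_of_le hθ.1 (by linarith [hθ.2]))
  rw [h1, h2]; norm_num

theorem lintegral_direction (a b : ℝ) :
    ∫⁻ θ in Set.Ioc 0 (2 * π), ‖a * cos θ + b * sin θ‖ₑ = 4 * ENNReal.ofReal (√(a ^ 2 + b ^ 2)) := by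
  set z : ℂ := ⟨a, b⟩ with hz
  set r := ‖z‖ with hr
  set φ := z.arg with hφ
  have ha : a = r * cos φ := (Complex.norm_mul_cos_arg z).symm
  have hb : b = r * sin φ := (Complex.norm_mul_sin_arg z).symm
  have hr0 : 0 ≤ r := norm_nonneg z
  have hsq : √(a ^ 2 + b ^ 2) = r := by
    rw [← Real.sqrt_sq hr0]
    congr 1
    rw [ha, hb]
    linear_combination r ^ 2 * (sin_sq_add_cos_sq φ)
  have hfun : ∀ θ, ‖a * cos θ + b * sin θ‖ₑ = ENNReal.ofReal (r * |cos (θ - φ)|) := by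
    intro θ
    rw [Real.enorm_eq_ofReal_abs]
    congr 1
    have : a * cos θ + b * sin θ = r * cos (θ - φ) := by
      rw [cos_sub]
      conv_lhs => rw [ha, hb]
      ring
    rw [this, abs_mul, abs_of_nonneg hr0]
  simp only [hfun]
  have hcont : Continuous fun θ : ℝ => r * |cos (θ - φ)| := by fun_prop
  rw [← ofReal_integral_eq_lintegral_ofReal, ← intervalIntegral.integral_of_le (by positivity),
    intervalIntegral.integral_const_mul, hsq]
  · have hper : Function.Periodic (fun θ : ℝ => |cos θ|) (2 * π) := fun θ => by
      simp only [cos_add_two_pi]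
    have h := hper.intervalIntegral_add_eq (0 - φ) 0
    rw [zero_add, integral_abs_cos_period] at h
    rw [intervalIntegral.integral_comp_sub_right (fun θ => |cos θ|)]
    have e : 2 * π - φ = 0 - φ + 2 * π := by ring
    rw [e, h, mul_comm, ENNReal.ofReal_mul (by norm_num)]
    norm_num
  · exact hcont.integrableOn_Ioc
  · exact Eventually.of_forall fun θ => mul_nonneg hr0 (abs_nonneg _)

theorem infDist_eq_infDist_frontier {U : Set (Eu 2)} (hU : U.Nonempty) {x : Eu 2}
    (hx : x ∉ closure U) :
    infDist x (frontier U) = infDist x (closure U) ∧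
      ∃ z ∈ frontier U, dist x z = infDist x (closure U) := by
  obtain ⟨z, hz, hzd⟩ := isClosed_closure.exists_infDist_eq_dist hU.closure x
  have hzf : z ∈ frontier U := by
    apply frontier_closure_subset
    rw [frontier_eq_closure_inter_closure, closure_closure]
    refine ⟨hz, ?_⟩
    have hne : dist x z ≠ 0 := fun hc => hx (by rwa [dist_eq_zero.1 hc])
    have hball : ball x (dist x z) ⊆ (closure U)ᶜ := by
      intro y hy hyc
      rw [mem_ball'] at hy
      have := infDist_le_dist_of_mem (x := x) hyc
      linarith
    apply closure_mono hball
    rw [closure_ball x hne, mem_closedBall']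
  refine ⟨le_antisymm ?_ ?_, z, hzf, hzd.symm⟩
  · rw [hzd]; exact infDist_le_dist_of_mem hzf
  · exact infDist_le_infDist_of_subset frontier_subset_closure ⟨z, hzf⟩

theorem isPreconnected_compl_closedBall (M : ℝ) : IsPreconnected (closedBall (0 : Eu 2) M)ᶜ := by
  have hrank : 1 < Module.rank ℝ (Eu 2) := by
    rw [← Module.finrank_eq_rank]
    simp
  rcases lt_or_ge M 0 with hM | hM
  · rw [closedBall_eq_empty.2 hM, Set.compl_empty]
    exact isPreconnected_univ
  have hs := (isConnected_sphere hrank (0 : Eu 2) zero_le_one).isPreconnected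
  have : (closedBall (0 : Eu 2) M)ᶜ =
      (fun p : ℝ × Eu 2 => p.1 • p.2) '' (Set.Ioi M ×ˢ sphere (0 : Eu 2) 1) := by
    ext x
    simp only [Set.mem_compl_iff, mem_closedBall_zero_iff, not_le, Set.mem_image, Set.mem_prod,
      Set.mem_Ioi, mem_sphere_iff_norm, sub_zero, Prod.exists]
    constructor
    · intro hx
      have hx0 : ‖x‖ ≠ 0 := (hM.trans_lt hx).ne'
      refine ⟨‖x‖, ‖x‖⁻¹ • x, ⟨hx, ?_⟩, ?_⟩
      · rw [norm_smul, norm_inv, norm_norm, inv_mul_cancel₀ hx0]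
      · rw [smul_smul, mul_inv_cancel₀ hx0, one_smul]
    · rintro ⟨r, u, ⟨hr, hu⟩, rfl⟩
      rw [norm_smul, hu, mul_one, Real.norm_eq_abs]
      exact hr.trans_le (le_abs_self r)
  rw [this]
  exact (isPreconnected_Ioi.prod hs).image _ (by fun_prop)

theorem connectedComponentIn_subset_unboundedPart {Ω : Set (Eu 2)} {x : Eu 2}
    (hx : x ∈ unboundedPart Ω) : connectedComponentIn (closure Ω)ᶜ x ⊆ unboundedPart Ω := by
  intro y hy
  refine ⟨connectedComponentIn_subset _ _ hy, ?_⟩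
  rw [← connectedComponentIn_eq hy]
  exact hx.2

theorem isOpen_unboundedPart (Ω : Set (Eu 2)) : IsOpen (unboundedPart Ω) := by
  rw [isOpen_iff_mem_nhds]
  intro x hx
  exact mem_of_superset (isClosed_closure.isOpen_compl.connectedComponentIn.mem_nhds
    (mem_connectedComponentIn hx.1)) (connectedComponentIn_subset_unboundedPart hx)

theorem not_isBounded_compl_closedBall (M : ℝ) :
    ¬ Bornology.IsBounded (closedBall (0 : Eu 2) M)ᶜ := by
  intro hb
  have hu : Bornology.IsBounded (Set.univ : Set (Eu 2)) := by
    rw [← Set.union_compl_self (closedBall (0 : Eu 2) M)]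
    exact isBounded_closedBall.union hb
  exact NormedSpace.unbounded_univ ℝ (Eu 2) hu

theorem compl_closedBall_subset_unboundedPart {Ω : Set (Eu 2)} {M : ℝ}
    (hM : closure Ω ⊆ closedBall 0 M) : (closedBall (0 : Eu 2) M)ᶜ ⊆ unboundedPart Ω := by
  intro x hx
  have hsub := Set.compl_subset_compl.2 hM
  refine ⟨hsub hx, fun hb => not_isBounded_compl_closedBall M (hb.subset ?_)⟩
  exact (isPreconnected_compl_closedBall M).subset_connectedComponentIn hx hsub

theorem isPreconnected_unboundedPart {Ω : Set (Eu 2)} {M : ℝ}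
    (hM : closure Ω ⊆ closedBall 0 M) : IsPreconnected (unboundedPart Ω) := by
  have hsub := Set.compl_subset_compl.2 hM
  obtain ⟨p, hp⟩ : ((closedBall (0 : Eu 2) M)ᶜ).Nonempty := by
    rw [Set.nonempty_iff_ne_empty]
    intro hc
    exact not_isBounded_compl_closedBall M (by rw [hc]; exact Bornology.isBounded_empty)
  have hbig := (isPreconnected_compl_closedBall M).subset_connectedComponentIn hp hsub
  have : unboundedPart Ω = connectedComponentIn (closure Ω)ᶜ p := by
    apply Set.Subset.antisymm
    · intro x hx
      obtain ⟨y, hy, hyM⟩ : ∃ y ∈ connectedComponentIn (closure Ω)ᶜ x, y ∉ closedBall (0 : Eu 2) M := by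
        by_contra hc
        push Not at hc
        exact hx.2 (isBounded_closedBall.subset hc)
      rw [connectedComponentIn_eq (hbig hyM), ← connectedComponentIn_eq hy]
      exact mem_connectedComponentIn hx.1
    · exact connectedComponentIn_subset_unboundedPart (compl_closedBall_subset_unboundedPart hM hp)
  rw [this]
  exact isPreconnected_connectedComponentIn

theorem frontier_unboundedPart_subset {Ω : Set (Eu 2)} (hΩ : IsOpen Ω) :
    frontier (unboundedPart Ω) ⊆ frontier Ω := by
  intro x hx
  rw [(isOpen_unboundedPart Ω).frontier_eq] at hx
  rw [hΩ.frontier_eq]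
  refine ⟨?_, fun hxΩ => ?_⟩
  · by_contra hxc
    obtain ⟨y, hy, hyU⟩ := mem_closure_iff.1 hx.1 _
      (isClosed_closure.isOpen_compl.connectedComponentIn (x := x)) (mem_connectedComponentIn hxc)
    apply hx.2
    have := connectedComponentIn_subset_unboundedPart hyU
    rw [← connectedComponentIn_eq hy] at this
    exact this (mem_connectedComponentIn hxc)
  · obtain ⟨y, hy, hyU⟩ := mem_closure_iff.1 hx.1 _ hΩ hxΩ
    exact hyU.1 (subset_closure hy)

theorem subset_innerRegion {Ω : Set (Eu 2)} (hΩ : IsOpen Ω) : Ω ⊆ innerRegion Ω := by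
  intro x hx hc
  obtain ⟨y, hy, hyU⟩ := mem_closure_iff.1 hc _ hΩ hx
  exact hyU.1 (subset_closure hy)

theorem exists_lt_infDist_of_lt_innerRadius {Ω : Set (Eu 2)} (hΩ : IsOpen Ω) (hne : Ω.Nonempty)
    (hU : (unboundedPart Ω).Nonempty) {t : ℝ} (ht : t < innerRadius Ω) :
    ∃ x, t < infDist x (closure (unboundedPart Ω)) := by
  obtain ⟨_, ⟨x, hx, rfl⟩, htx⟩ := exists_lt_of_lt_csSup
    ((hne.mono (subset_innerRegion hΩ)).image _) ht
  refine ⟨x, ?_⟩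
  rw [← (infDist_eq_infDist_frontier hU hx).1]
  exact htx

theorem IsPreconnected.subset_of_disjoint_frontier {X : Type*} [TopologicalSpace X] {A U : Set X}
    (hA : IsPreconnected A) (hU : IsOpen U) (hd : Disjoint A (frontier U)) (hm : (A ∩ U).Nonempty) :
    A ⊆ U := by
  refine hA.subset_left_of_subset_union hU isClosed_closure.isOpen_compl
    (Set.disjoint_compl_right_iff_subset.2 subset_closure) ?_ hm
  intro x hx
  by_cases hxU : x ∈ U
  · exact Or.inl hxU
  · refine Or.inr fun hc => Set.disjoint_left.1 hd hx ?_
    rw [hU.frontier_eq]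
    exact ⟨hc, hxU⟩

namespace IsC2JordanCurve

variable {γ : ℝ → Eu 2}

theorem continuous (h : IsC2JordanCurve γ) : Continuous γ := h.1.continuous

theorem apply_fract (h : IsC2JordanCurve γ) (s : ℝ) : γ (Int.fract s) = γ s := by
  have := h.2.1.sub_zsmul_eq (x := s) ⌊s⌋
  simpa using this

theorem exists_eq_add_int (h : IsC2JordanCurve γ) {s t : ℝ} (hst : γ s = γ t) :
    ∃ k : ℤ, s = t + k := by
  rw [← h.apply_fract s, ← h.apply_fract t] at hst
  have := h.2.2.1 _ ⟨Int.fract_nonneg s, Int.fract_lt_one s⟩ _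
    ⟨Int.fract_nonneg t, Int.fract_lt_one t⟩ hst
  refine ⟨⌊s⌋ - ⌊t⌋, ?_⟩
  push_cast
  rw [Int.fract, Int.fract] at this
  linarith

theorem range_eq (h : IsC2JordanCurve γ) : Set.range γ = γ '' Set.Ico 0 1 := by
  ext x
  constructor
  · rintro ⟨s, rfl⟩
    exact ⟨Int.fract s, ⟨Int.fract_nonneg s, Int.fract_lt_one s⟩, h.apply_fract s⟩
  · rintro ⟨s, -, rfl⟩
    exact ⟨s, rfl⟩

theorem isCompact_range (h : IsC2JordanCurve γ) : IsCompact (Set.range γ) := by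
  have : Set.range γ = γ '' Set.Icc 0 1 := by
    apply Set.Subset.antisymm
    · rw [h.range_eq]
      exact Set.image_mono Set.Ico_subset_Icc_self
    · exact Set.image_subset_range _ _
  rw [this]
  exact isCompact_Icc.image h.continuous

theorem hasDerivAt (h : IsC2JordanCurve γ) (s : ℝ) : HasDerivAt γ (deriv γ s) s :=
  (h.1.differentiable (by norm_num) s).hasDerivAt

theorem hasStrictDerivAt (h : IsC2JordanCurve γ) (s : ℝ) : HasStrictDerivAt γ (deriv γ s) s :=
  (h.1.contDiffAt.hasStrictDerivAt (by norm_num))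

theorem contDiff_deriv (h : IsC2JordanCurve γ) : ContDiff ℝ 1 (deriv γ) := by
  have h2 : ContDiff ℝ (1 + 1) γ := by
    have : (1 + 1 : WithTop ℕ∞) = 2 := by norm_num
    rw [this]; exact h.1
  exact (contDiff_succ_iff_deriv.1 h2).2.2

end IsC2JordanCurve

/-- The linear change of coordinates given by two independent vectors. -/
theorem exists_continuousLinearEquiv {v n : Eu 2}
    (hn : ∀ a b : ℝ, a • v + b • n = 0 → a = 0 ∧ b = 0) :
    ∃ L : (ℝ × ℝ) ≃L[ℝ] Eu 2, ∀ p, L p = p.1 • v + p.2 • n := by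
  let L₀ : (ℝ × ℝ) →ₗ[ℝ] Eu 2 :=
    (LinearMap.toSpanSingleton ℝ (Eu 2) v).coprod (LinearMap.toSpanSingleton ℝ (Eu 2) n)
  have hL₀ : ∀ p, L₀ p = p.1 • v + p.2 • n := fun p => by simp [L₀]
  have hinj : Function.Injective L₀ := by
    rw [← LinearMap.ker_eq_bot, LinearMap.ker_eq_bot']
    intro p hp
    rw [hL₀] at hp
    obtain ⟨h1, h2⟩ := hn _ _ hp
    exact Prod.ext h1 h2
  exact ⟨(L₀.linearEquivOfInjective hinj (by simp)).toContinuousLinearEquiv, hL₀⟩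

/-- Near a point of `frontier U`, one side of the boundary curve lies in `U`. -/
theorem exists_side_subset {N : ℕ} {γ : Fin N → ℝ → Eu 2} (hγ : ∀ i, IsC2JordanCurve (γ i))
    (hdisj : ∀ i j, i ≠ j → Disjoint (Set.range (γ i)) (Set.range (γ j)))
    {U : Set (Eu 2)} (hU : IsOpen U) (hUf : frontier U ⊆ ⋃ i, Set.range (γ i))
    (hUd : Disjoint U (⋃ i, Set.range (γ i))) {i : Fin N} {s₀ : ℝ}
    (hs₀ : γ i s₀ ∈ frontier U) {n : Eu 2}
    (hn : ∀ a b : ℝ, a • deriv (γ i) s₀ + b • n = 0 → a = 0 ∧ b = 0) :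
    ∃ σ : ℝ, (σ = 1 ∨ σ = -1) ∧ ∃ δ > 0, ∀ s, |s - s₀| < δ → ∀ r, 0 < r → r < δ →
      γ i s + (σ * r) • n ∈ U := by
  classical
  obtain ⟨L, hL⟩ := exists_continuousLinearEquiv hn
  set G : ℝ × ℝ → Eu 2 := fun p => γ i p.1 + p.2 • n with hG
  have hGc : Continuous G := by
    have := (hγ i).continuous
    fun_prop
  have hGd : HasStrictFDerivAt G (L : (ℝ × ℝ) →L[ℝ] Eu 2) (s₀, 0) := by
    have h1 : HasStrictFDerivAt (fun p : ℝ × ℝ => γ i p.1) _ (s₀, (0 : ℝ)) :=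
      ((hγ i).hasStrictDerivAt s₀).hasStrictFDerivAt.comp (s₀, (0 : ℝ)) hasStrictFDerivAt_fst
    have h2 : HasStrictFDerivAt (fun p : ℝ × ℝ => p.2 • n) _ (s₀, (0 : ℝ)) :=
      (hasStrictFDerivAt_snd (𝕜 := ℝ) (E := ℝ) (F := ℝ) (p := (s₀, (0 : ℝ)))).smul_const n
    refine (h1.add h2).congr_fderiv (ContinuousLinearMap.ext fun p => ?_)
    simp [hL]
  have hG0 : G (s₀, 0) = γ i s₀ := by simp [hG]
  obtain ⟨δ₀, hδ₀, hinj⟩ : ∃ δ₀ > 0, Set.InjOn G (ball (s₀, 0) δ₀) := by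
    obtain ⟨δ₀, hδ₀, hb⟩ := Metric.mem_nhds_iff.1
      ((hGd.toOpenPartialHomeomorph G).open_source.mem_nhds
        hGd.mem_toOpenPartialHomeomorph_source)
    exact ⟨δ₀, hδ₀, (hGd.toOpenPartialHomeomorph G).injOn.mono hb⟩
  set K : Set (Eu 2) := (⋃ j ∈ Finset.univ.filter (· ≠ i), Set.range (γ j)) ∪
    γ i '' Set.Icc (s₀ + δ₀) (s₀ + 1 - δ₀) with hK
  have hKc : IsClosed K := by
    refine IsClosed.union (isClosed_biUnion_finset fun j _ => (hγ j).isCompact_range.isClosed) ?_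
    exact (isCompact_Icc.image (hγ i).continuous).isClosed
  have hzK : γ i s₀ ∉ K := by
    rintro (h | ⟨s, hs, hss⟩)
    · obtain ⟨j, hj, hz⟩ := Set.mem_iUnion₂.1 h
      exact Set.disjoint_left.1 (hdisj j i (by simpa using hj)) hz ⟨s₀, rfl⟩
    · obtain ⟨k, hk⟩ := (hγ i).exists_eq_add_int hss
      have h1 : (0 : ℝ) < k := by linarith [hs.1]
      have h2 : (k : ℝ) < 1 := by linarith [hs.2]
      have h1' : 0 < k := by exact_mod_cast h1
      have h2' : k < 1 := by exact_mod_cast h2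
      omega
  have hcov : ∀ y ∈ ⋃ j, Set.range (γ j), y ∉ K → ∃ s, |s - s₀| < δ₀ ∧ γ i s = y := by
    intro y hy hyK
    obtain ⟨j, s, rfl⟩ := Set.mem_iUnion.1 hy
    by_cases hj : j = i
    · subst hj
      have hper : γ j (s₀ + Int.fract (s - s₀)) = γ j s := by
        have := (hγ j).2.1.sub_zsmul_eq (x := s) ⌊s - s₀⌋
        have h2 := Int.floor_add_fract (s - s₀)
        rw [← this]
        congr 1
        rw [zsmul_eq_mul, mul_one]
        linarith
      have hf0 := Int.fract_nonneg (s - s₀)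
      have hf1 := Int.fract_lt_one (s - s₀)
      by_cases h1 : Int.fract (s - s₀) < δ₀
      · exact ⟨_, by rw [add_sub_cancel_left, abs_of_nonneg hf0]; exact h1, hper⟩
      by_cases h2 : 1 - δ₀ < Int.fract (s - s₀)
      · refine ⟨s₀ + Int.fract (s - s₀) - 1, ?_, ?_⟩
        · rw [abs_lt]; constructor <;> linarith
        · rw [← hper]
          exact (hγ j).2.1.sub_eq _
      · refine (hyK (Or.inr ⟨s₀ + Int.fract (s - s₀), ⟨?_, ?_⟩, hper⟩)).elim
        · linarith
        · linarith
    · exact (hyK (Or.inl (Set.mem_iUnion₂.2 ⟨j, by simp [hj], s, rfl⟩))).elim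
  obtain ⟨δ₁, hδ₁, hb₁⟩ := Metric.mem_nhds_iff.1 (hGc.continuousAt.preimage_mem_nhds
    (hKc.isOpen_compl.mem_nhds (show G (s₀, 0) ∉ K by rwa [hG0])))
  set δ := min δ₀ δ₁ with hδ
  have hδpos : 0 < δ := lt_min hδ₀ hδ₁
  have hball : ∀ s r : ℝ, ∀ ρ, (s, r) ∈ ball (s₀, (0 : ℝ)) ρ ↔ |s - s₀| < ρ ∧ |r| < ρ := by
    intro s r ρ
    rw [mem_ball, Prod.dist_eq, max_lt_iff, Real.dist_eq, Real.dist_eq, sub_zero]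
  have hzero : ∀ s r, |s - s₀| < δ → |r| < δ → G (s, r) ∈ ⋃ j, Set.range (γ j) → r = 0 := by
    intro s r hs hr hmem
    have hnK : G (s, r) ∉ K := hb₁ ((hball _ _ _).2 ⟨hs.trans_le (min_le_right _ _),
      hr.trans_le (min_le_right _ _)⟩)
    obtain ⟨s', hs', hss⟩ := hcov _ hmem hnK
    have h1 : G (s', 0) = G (s, r) := by rw [← hss]; simp [hG]
    have := hinj ((hball _ _ _).2 ⟨hs', by simpa using hδ₀⟩)
      ((hball _ _ _).2 ⟨hs.trans_le (min_le_left _ _), hr.trans_le (min_le_left _ _)⟩) h1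
    exact (Prod.ext_iff.1 this).2.symm
  have hhalf : ∀ σ : ℝ, (σ = 1 ∨ σ = -1) → ∀ s₁ r₁, |s₁ - s₀| < δ → 0 < r₁ → r₁ < δ →
      G (s₁, σ * r₁) ∈ U → ∀ s, |s - s₀| < δ → ∀ r, 0 < r → r < δ → G (s, σ * r) ∈ U := by
    intro σ hσ s₁ r₁ hs₁ hr₁ hr₁' hmem s hs r hr hr'
    have hconv : IsPreconnected (Set.Ioo (s₀ - δ) (s₀ + δ) ×ˢ Set.Ioo 0 δ) :=
      isPreconnected_Ioo.prod isPreconnected_Ioo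
    have hcont : Continuous fun p : ℝ × ℝ => G (p.1, σ * p.2) := by fun_prop
    have hIoo : ∀ s, |s - s₀| < δ ↔ s ∈ Set.Ioo (s₀ - δ) (s₀ + δ) := by
      intro s
      rw [abs_lt, Set.mem_Ioo]
      constructor <;> rintro ⟨h1, h2⟩ <;> constructor <;> linarith
    have hpc := hconv.image _ hcont.continuousOn
    refine hpc.subset_of_disjoint_frontier hU ?_ ⟨_, ⟨(s₁, r₁), ⟨(hIoo _).1 hs₁, hr₁, hr₁'⟩, rfl⟩,
      hmem⟩ ⟨(s, r), ⟨(hIoo _).1 hs, hr, hr'⟩, rfl⟩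
    rw [Set.disjoint_left]
    rintro _ ⟨⟨a, b⟩, ⟨ha, hb⟩, rfl⟩ hf
    have := hzero a (σ * b) ((hIoo _).2 ha) ?_ (hUf hf)
    · have hb' : 0 < b := hb.1
      rcases hσ with rfl | rfl
      · linarith
      · linarith
    · have hb0 : 0 < b := hb.1
      have hb1 : b < δ := hb.2
      rcases hσ with rfl | rfl
      · rw [one_mul, abs_of_pos hb0]; exact hb1
      · rw [neg_one_mul, abs_neg, abs_of_pos hb0]; exact hb1
  -- some point of `U` lies in the chart
  have hnhds : G '' ball (s₀, 0) δ ∈ nhds (γ i s₀) := by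
    rw [← hG0, ← hGd.map_nhds_eq_of_equiv]
    exact image_mem_map (ball_mem_nhds _ hδpos)
  obtain ⟨_, ⟨⟨s₁, r₁⟩, hb, rfl⟩, hmU⟩ := mem_closure_iff_nhds.1 (frontier_subset_closure hs₀) _ hnhds
  rw [hball] at hb
  have hr₁ : r₁ ≠ 0 := by
    rintro rfl
    refine Set.disjoint_left.1 hUd hmU (Set.mem_iUnion.2 ⟨i, s₁, ?_⟩)
    simp [hG]
  rcases lt_or_gt_of_ne hr₁ with hneg | hpos
  · refine ⟨-1, Or.inr rfl, δ, hδpos, ?_⟩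
    refine hhalf (-1) (Or.inr rfl) s₁ (-r₁) hb.1 (by linarith) ?_ (by simpa using hmU)
    rw [← abs_of_neg hneg]; exact hb.2
  · refine ⟨1, Or.inl rfl, δ, hδpos, ?_⟩
    refine hhalf 1 (Or.inl rfl) s₁ r₁ hb.1 hpos ?_ (by simpa using hmU)
    rw [← abs_of_pos hpos]; exact hb.2

/-- The quarter turn of the plane. -/
def quarterTurn : Eu 2 →L[ℝ] Eu 2 :=
  LinearMap.toContinuousLinearMap
    { toFun := fun v => !₂[-(v 1), v 0]
      map_add' := fun v w => by ext i; fin_cases i <;> simp; ring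
      map_smul' := fun a v => by ext i; fin_cases i <;> simp }

theorem quarterTurn_zero_apply (v : Eu 2) : quarterTurn v 0 = -(v 1) := rfl

theorem quarterTurn_one_apply (v : Eu 2) : quarterTurn v 1 = v 0 := rfl

theorem Eu.ext_two {v w : Eu 2} (h0 : v 0 = w 0) (h1 : v 1 = w 1) : v = w := by
  ext i; fin_cases i
  · exact h0
  · exact h1

theorem Eu.norm_sq (v : Eu 2) : ‖v‖ ^ 2 = v 0 ^ 2 + v 1 ^ 2 := by
  rw [EuclideanSpace.norm_sq_eq, Fin.sum_univ_two, Real.norm_eq_abs, Real.norm_eq_abs, sq_abs,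
    sq_abs]

theorem Eu.inner_eq (v w : Eu 2) : ⟪v, w⟫ = v 0 * w 0 + v 1 * w 1 := by
  rw [PiLp.inner_apply, Fin.sum_univ_two]
  simp [mul_comm]

theorem norm_quarterTurn (v : Eu 2) : ‖quarterTurn v‖ = ‖v‖ := by
  rw [← sq_eq_sq₀ (norm_nonneg _) (norm_nonneg _), Eu.norm_sq, Eu.norm_sq, quarterTurn_zero_apply,
    quarterTurn_one_apply]
  ring

theorem inner_quarterTurn (v : Eu 2) : ⟪quarterTurn v, v⟫ = 0 := by
  rw [Eu.inner_eq, quarterTurn_zero_apply, quarterTurn_one_apply]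
  ring

/-- The coordinates of the plane with first axis `(cos θ, sin θ)`. -/
def rotFrame (θ : ℝ) : Frame (Eu 2) where
  h x := x 0 * cos θ + x 1 * sin θ
  ξ x := -(x 0 * sin θ) + x 1 * cos θ
  pt a b := !₂[a * cos θ - b * sin θ, a * sin θ + b * cos θ]
  h_pt a b := by
    simp only [Matrix.cons_val_zero, Matrix.cons_val_one]
    linear_combination a * Real.sin_sq_add_cos_sq θ
  ξ_pt a b := by
    simp only [Matrix.cons_val_zero, Matrix.cons_val_one]
    linear_combination b * Real.sin_sq_add_cos_sq θ
  pt_h x := by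
    apply Eu.ext_two <;> simp only [Matrix.cons_val_zero, Matrix.cons_val_one]
    · linear_combination x 0 * Real.sin_sq_add_cos_sq θ
    · linear_combination x 1 * Real.sin_sq_add_cos_sq θ
  dist_sq x y := by
    rw [dist_eq_norm, Eu.norm_sq, PiLp.sub_apply, PiLp.sub_apply]
    linear_combination (-(x 0 - y 0) ^ 2 - (x 1 - y 1) ^ 2) * Real.sin_sq_add_cos_sq θ

theorem rotFrame_pt_add (θ : ℝ) (p : Eu 2) (η : ℝ) :
    (rotFrame θ).pt ((rotFrame θ).h p) ((rotFrame θ).ξ p + η) = p + η • !₂[-sin θ, cos θ] := by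
  conv_rhs => rw [← (rotFrame θ).pt_h p]
  apply Eu.ext_two <;> simp [rotFrame] <;> ring

/-- A curve of the family either lies in `frontier U` or avoids it. -/
theorem range_subset_or_disjoint_frontier {N : ℕ} {γ : Fin N → ℝ → Eu 2}
    (hγ : ∀ i, IsC2JordanCurve (γ i))
    (hdisj : ∀ i j, i ≠ j → Disjoint (Set.range (γ i)) (Set.range (γ j)))
    {U : Set (Eu 2)} (hU : IsOpen U) (hUf : frontier U ⊆ ⋃ i, Set.range (γ i))
    (hUd : Disjoint U (⋃ i, Set.range (γ i))) (i : Fin N) :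
    Set.range (γ i) ⊆ frontier U ∨ Disjoint (Set.range (γ i)) (frontier U) := by
  have hclopen : IsClopen (γ i ⁻¹' frontier U) := by
    refine ⟨isClosed_frontier.preimage (hγ i).continuous, ?_⟩
    rw [Metric.isOpen_iff]
    intro s₀ hs₀
    have hind : ∀ a b : ℝ, a • deriv (γ i) s₀ + b • quarterTurn (deriv (γ i) s₀) = 0 →
        a = 0 ∧ b = 0 := by
      intro a b hab
      have hv : 0 < ‖deriv (γ i) s₀‖ ^ 2 := by have := norm_pos_iff.2 ((hγ i).2.2.2 s₀); positivity
      rw [Eu.norm_sq] at hv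
      have e0 := congrArg (fun v : Eu 2 => v 0) hab
      have e1 := congrArg (fun v : Eu 2 => v 1) hab
      simp only [PiLp.add_apply, PiLp.smul_apply, quarterTurn_zero_apply, quarterTurn_one_apply,
        smul_eq_mul, PiLp.zero_apply] at e0 e1
      constructor
      · refine (mul_eq_zero.1 ?_).resolve_right hv.ne'
        linear_combination (deriv (γ i) s₀ 0) * e0 + (deriv (γ i) s₀ 1) * e1
      · refine (mul_eq_zero.1 ?_).resolve_right hv.ne'
        linear_combination (deriv (γ i) s₀ 0) * e1 - (deriv (γ i) s₀ 1) * e0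
    obtain ⟨σ, -, δ, hδ, hside⟩ := exists_side_subset hγ hdisj hU hUf hUd hs₀ hind
    refine ⟨δ, hδ, fun s hs => ?_⟩
    have hs' : |s - s₀| < δ := by simpa [Real.dist_eq] using hs
    rw [Set.mem_preimage, frontier, hU.interior_eq]
    refine ⟨?_, fun hc => Set.disjoint_left.1 hUd hc (Set.mem_iUnion.2 ⟨i, s, rfl⟩)⟩
    have hcont : Continuous fun r : ℝ => γ i s + (σ * r) • quarterTurn (deriv (γ i) s₀) := by
      fun_prop
    have htend := (hcont.tendsto 0).mono_left (nhdsWithin_le_nhds (s := Set.Ioi 0))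
    simp only [mul_zero, zero_smul, add_zero] at htend
    refine mem_closure_of_tendsto htend ?_
    filter_upwards [Ioo_mem_nhdsGT hδ] with r hr
    exact hside s hs' r hr.1 hr.2
  rcases isClopen_iff.1 hclopen with h | h
  · right
    rw [Set.disjoint_left]
    rintro _ ⟨s, rfl⟩ hs
    have : s ∈ γ i ⁻¹' frontier U := hs
    rw [h] at this
    exact this
  · left
    rintro _ ⟨s, rfl⟩
    have : s ∈ γ i ⁻¹' frontier U := by rw [h]; trivial
    exact this

/-- The outer boundary of a `C²` domain is a finite disjoint union of `C²` Jordan curves, and every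
transversal to it enters the unbounded component on one side. -/
theorem IsC2Domain.exists_outer_curves {Ω : Set (Eu 2)} (hΩ : IsC2Domain Ω) :
    ∃ (ι : Type) (_ : Fintype ι) (γ : ι → ℝ → Eu 2), (∀ i, IsC2JordanCurve (γ i)) ∧
      (∀ i j, i ≠ j → Disjoint (Set.range (γ i)) (Set.range (γ j))) ∧
      outerBoundary Ω = (⋃ i, Set.range (γ i)) ∧
      ∀ i s n, (∀ a b : ℝ, a • deriv (γ i) s + b • n = 0 → a = 0 ∧ b = 0) →
        ∃ σ : ℝ, (σ = 1 ∨ σ = -1) ∧ ∃ δ > 0, ∀ r, 0 < r → r < δ →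
          γ i s + (σ * r) • n ∈ unboundedPart Ω := by
  classical
  obtain ⟨hΩo, -, hΩb, N, γ, hγ, hdisj, hfr⟩ := hΩ
  have hU : IsOpen (unboundedPart Ω) := isOpen_unboundedPart Ω
  have hUf : frontier (unboundedPart Ω) ⊆ ⋃ i, Set.range (γ i) :=
    hfr ▸ frontier_unboundedPart_subset hΩo
  have hUd : Disjoint (unboundedPart Ω) (⋃ i, Set.range (γ i)) := by
    rw [← hfr, Set.disjoint_left]
    exact fun x hx hx' => hx.1 (frontier_subset_closure hx')
  refine ⟨{i // Set.range (γ i) ⊆ frontier (unboundedPart Ω)}, inferInstance, fun i => γ i,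
    fun i => hγ i, fun i j hij => hdisj i j fun h => hij (Subtype.ext h), ?_, ?_⟩
  · apply Set.Subset.antisymm
    · intro x hx
      obtain ⟨i, hi⟩ := Set.mem_iUnion.1 (hUf hx)
      rcases range_subset_or_disjoint_frontier hγ hdisj hU hUf hUd i with h | h
      · exact Set.mem_iUnion.2 ⟨⟨i, h⟩, hi⟩
      · exact absurd hx (Set.disjoint_left.1 h hi)
    · exact Set.iUnion_subset fun i => i.2
  · intro i s n hn
    obtain ⟨σ, hσ, δ, hδ, h⟩ := exists_side_subset hγ hdisj hU hUf hUd (i.2 ⟨s, rfl⟩) hn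
    exact ⟨σ, hσ, δ, hδ, h s (by simpa using hδ)⟩

theorem cnt_union_le {α : Type*} (S T : Set α) : cnt (S ∪ T) ≤ cnt S + cnt T := by
  rw [cnt, cnt, cnt, ← ENat.toENNReal_add]
  exact ENat.toENNReal_mono (Set.encard_union_le S T)

theorem cnt_union_eq {α : Type*} {S T : Set α} (h : Disjoint S T) :
    cnt (S ∪ T) = cnt S + cnt T := by
  rw [cnt, cnt, cnt, ← ENat.toENNReal_add, Set.encard_union_eq h]

theorem cnt_image_le {α β : Type*} (f : α → β) (S : Set α) : cnt (f '' S) ≤ cnt S :=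
  ENat.toENNReal_mono (Set.encard_image_le f S)

theorem cnt_image_eq {α β : Type*} {f : α → β} {S : Set α} (h : Set.InjOn f S) :
    cnt (f '' S) = cnt S := by
  rw [cnt, cnt, h.encard_image]

theorem cnt_biUnion_le {ι α : Type*} (s : Finset ι) (S : ι → Set α) :
    cnt (⋃ i ∈ s, S i) ≤ ∑ i ∈ s, cnt (S i) := by
  classical
  induction s using Finset.induction_on with
  | empty => simp [cnt_empty]
  | insert a s ha ih =>
    rw [Finset.sum_insert ha, Finset.set_biUnion_insert]
    exact (cnt_union_le _ _).trans (add_le_add le_rfl ih)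

theorem cnt_biUnion_eq {ι α : Type*} (s : Finset ι) {S : ι → Set α}
    (h : ∀ i j, i ≠ j → Disjoint (S i) (S j)) :
    cnt (⋃ i ∈ s, S i) = ∑ i ∈ s, cnt (S i) := by
  classical
  induction s using Finset.induction_on with
  | empty => simp [cnt_empty]
  | insert a s ha ih =>
    rw [Finset.sum_insert ha, Finset.set_biUnion_insert, cnt_union_eq, ih]
    rw [Set.disjoint_iUnion₂_right]
    exact fun j hj => h a j fun hc => ha (hc ▸ hj)

/-- Counting the preimages of a set under a family of maps, jointly injective. -/
theorem sum_cnt_le_cnt_add_cnt_neg {ι α : Type*} [Fintype ι] {S : ι → Set α} {e : ι → α → ℝ}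
    {A B : Set ℝ} (hinj : ∀ i, ∀ s ∈ S i, ∀ j, ∀ u ∈ S j, e i s = e j u → i = j ∧ s = u)
    (hAB : ∀ i, ∀ s ∈ S i, e i s ∈ A ∨ -e i s ∈ B) :
    ∑ i, cnt (S i) ≤ cnt A + cnt B := by
  calc ∑ i, cnt (S i) = ∑ i, cnt (e i '' S i) :=
        Finset.sum_congr rfl fun i _ => (cnt_image_eq fun s hs u hu h =>
          (hinj i s hs i u hu h).2).symm
    _ = cnt (⋃ i ∈ Finset.univ, e i '' S i) := by
        refine (cnt_biUnion_eq _ fun i j hij => ?_).symm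
        rw [Set.disjoint_left]
        rintro _ ⟨s, hs, rfl⟩ ⟨u, hu, h⟩
        exact hij (hinj j u hu i s hs h).1.symm
    _ ≤ cnt (A ∪ (fun x => -x) '' B) := by
        refine cnt_mono (Set.iUnion₂_subset fun i _ => ?_)
        rintro _ ⟨s, hs, rfl⟩
        rcases hAB i s hs with h | h
        · exact Or.inl h
        · exact Or.inr ⟨_, h, neg_neg _⟩
    _ ≤ cnt A + cnt B := (cnt_union_le _ _).trans (add_le_add le_rfl (cnt_image_le _ _))

/-- Two sets of disjoint points covered by a family of maps. -/
theorem cnt_add_cnt_neg_le_sum {ι α : Type*} [Fintype ι] {S : ι → Set α} {e : ι → α → ℝ}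
    {A B : Set ℝ} (hd : ∀ x ∈ A, -x ∉ B)
    (hA : ∀ x ∈ A, ∃ i, ∃ s ∈ S i, e i s = x) (hB : ∀ x ∈ B, ∃ i, ∃ s ∈ S i, e i s = -x) :
    cnt A + cnt B ≤ ∑ i, cnt (S i) := by
  calc cnt A + cnt B = cnt A + cnt ((fun x => -x) '' B) := by
        rw [cnt_image_eq neg_injective.injOn]
    _ = cnt (A ∪ (fun x => -x) '' B) := by
        refine (cnt_union_eq ?_).symm
        rw [Set.disjoint_left]
        rintro x hx ⟨u, hu, rfl⟩
        exact hd _ hx (by simpa using hu)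
    _ ≤ cnt (⋃ i ∈ Finset.univ, e i '' S i) := by
        refine cnt_mono ?_
        rintro x (hx | ⟨u, hu, rfl⟩)
        · obtain ⟨i, s, hs, rfl⟩ := hA x hx
          exact Set.mem_iUnion₂.2 ⟨i, Finset.mem_univ i, s, hs, rfl⟩
        · obtain ⟨i, s, hs, h⟩ := hB u hu
          exact Set.mem_iUnion₂.2 ⟨i, Finset.mem_univ i, s, hs, h⟩
    _ ≤ ∑ i, cnt (S i) := (cnt_biUnion_le _ _).trans
        (Finset.sum_le_sum fun i _ => cnt_image_le _ _)

theorem hasDerivAt_rotFrame_h (θ : ℝ) {c : ℝ → Eu 2} {v : Eu 2} {s : ℝ} (hc : HasDerivAt c v s) :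
    HasDerivAt (fun s => (rotFrame θ).h (c s)) ((rotFrame θ).h v) s := by
  have h0 := (EuclideanSpace.proj (𝕜 := ℝ) (0 : Fin 2)).hasFDerivAt.comp_hasDerivAt s hc
  have h1 := (EuclideanSpace.proj (𝕜 := ℝ) (1 : Fin 2)).hasFDerivAt.comp_hasDerivAt s hc
  exact (h0.mul_const (cos θ)).add (h1.mul_const (sin θ))

theorem Frame.mem_closure_compl_of_mem_entrySet {E : Type*} [MetricSpace E] (F : Frame E)
    {C : Set E} {y z : ℝ} (hz : z ∈ F.entrySet C y) : F.pt y z ∈ closure Cᶜ := by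
  have hcont : Continuous fun η => F.pt y (z - η) :=
    (F.continuous_pt_right y).comp (by fun_prop)
  have h := (hcont.tendsto 0).mono_left (nhdsWithin_le_nhds (s := Set.Ioi 0))
  simp only [sub_zero] at h
  exact mem_closure_of_tendsto h hz.2

/-- The number of entries of a line into `C` is at most the number of its intersections with the
curves, at regular heights. -/
theorem cnt_entrySet_add_le {ι : Type*} [Fintype ι] {γ : ι → ℝ → Eu 2}
    (hγ : ∀ i, IsC2JordanCurve (γ i)) {U : Set (Eu 2)}
    (hfr : frontier U = ⋃ i, Set.range (γ i))
    (hside : ∀ i s n, (∀ a b : ℝ, a • deriv (γ i) s + b • n = 0 → a = 0 ∧ b = 0) →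
        ∃ σ : ℝ, (σ = 1 ∨ σ = -1) ∧ ∃ δ > 0, ∀ r, 0 < r → r < δ → γ i s + (σ * r) • n ∈ U)
    (θ : ℝ) {y : ℝ} (hy : ∀ i, ∀ s ∈ Set.Ico (0 : ℝ) 1, (rotFrame θ).h (γ i s) = y →
      (rotFrame θ).h (deriv (γ i) s) ≠ 0) :
    cnt ((rotFrame θ).entrySet (closure U) y) + cnt ((rotFrame θ).mirror.entrySet (closure U) y) ≤
      ∑ i, cnt {s ∈ Set.Ico (0 : ℝ) 1 | (rotFrame θ).h (γ i s) = y ∧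
        (rotFrame θ).h (deriv (γ i) s) ≠ 0} := by
  set F := rotFrame θ with hF
  have hmem : ∀ p ∈ closure U, p ∈ closure (closure U)ᶜ → F.h p = y → ∃ i,
      ∃ s ∈ {s ∈ Set.Ico (0 : ℝ) 1 | F.h (γ i s) = y ∧ F.h (deriv (γ i) s) ≠ 0}, γ i s = p := by
    intro p hp hp' hpy
    have : p ∈ frontier U := by
      apply frontier_closure_subset
      rw [frontier_eq_closure_inter_closure, closure_closure]
      exact ⟨hp, hp'⟩
    rw [hfr] at this
    obtain ⟨i, hi⟩ := Set.mem_iUnion.1 this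
    rw [(hγ i).range_eq] at hi
    obtain ⟨s, hs, rfl⟩ := hi
    exact ⟨i, s, ⟨hs, hpy, hy i s hs hpy⟩, rfl⟩
  refine cnt_add_cnt_neg_le_sum (e := fun i s => F.ξ (γ i s)) ?_ ?_ ?_
  · intro x hx hx'
    obtain ⟨i, s, ⟨-, hs, hreg⟩, hp⟩ := hmem _ hx.1 (F.mem_closure_compl_of_mem_entrySet hx)
      (F.h_pt _ _)
    have hxx : F.ξ (γ i s) = x := by rw [hp, F.ξ_pt]
    have hind : ∀ a b : ℝ, a • deriv (γ i) s + b • !₂[-sin θ, cos θ] = 0 → a = 0 ∧ b = 0 := by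
      intro a b hab
      have e0 := congrArg (fun v : Eu 2 => v 0) hab
      have e1 := congrArg (fun v : Eu 2 => v 1) hab
      simp at e0 e1
      have ha : a = 0 := by
        refine (mul_eq_zero.1 ?_).resolve_right hreg
        simp only [hF, rotFrame]
        linear_combination cos θ * e0 + sin θ * e1
      refine ⟨ha, ?_⟩
      subst ha
      linear_combination -sin θ * e0 + cos θ * e1 - b * Real.sin_sq_add_cos_sq θ
    obtain ⟨σ, hσ, δ, hδ, hU⟩ := hside i s _ hind
    have hpt : ∀ η, F.pt y (x + η) = γ i s + η • !₂[-sin θ, cos θ] := by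
      intro η
      rw [← rotFrame_pt_add, ← hF, hs, hxx]
    rcases hσ with rfl | rfl
    · obtain ⟨η, hη, hη'⟩ := (hx'.2.and (Ioo_mem_nhdsGT hδ)).exists
      refine hη (subset_closure ?_)
      have := hU η hη'.1 hη'.2
      rw [one_mul, ← hpt] at this
      convert this using 1
      simp [Frame.mirror]
      ring_nf
    · obtain ⟨η, hη, hη'⟩ := (hx.2.and (Ioo_mem_nhdsGT hδ)).exists
      refine hη (subset_closure ?_)
      have := hU η hη'.1 hη'.2
      rw [neg_one_mul, ← hpt] at this
      exact this
  · intro x hx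
    obtain ⟨i, s, hs, hp⟩ := hmem _ hx.1 (F.mem_closure_compl_of_mem_entrySet hx) (F.h_pt _ _)
    exact ⟨i, s, hs, by rw [hp, F.ξ_pt]⟩
  · intro x hx
    obtain ⟨i, s, hs, hp⟩ := hmem _ hx.1 (F.mirror.mem_closure_compl_of_mem_entrySet hx)
      (F.mirror.h_pt _ _)
    refine ⟨i, s, hs, ?_⟩
    have : -F.ξ (γ i s) = x := by
      rw [hp]
      exact F.mirror.ξ_pt y x
    linarith

section Normal

variable {V : Type*} [NormedAddCommGroup V] [InnerProductSpace ℝ V]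

/-- Points between a foot point and a point realizing its distance realize theirs. -/
theorem infDist_add_smul_eq_of_le {C : Set V} {c ν : V} (hc : c ∈ C) (hν : ‖ν‖ = 1) {t r : ℝ}
    (ht : 0 ≤ t) (htr : t ≤ r) (h : infDist (c + r • ν) C = r) : infDist (c + t • ν) C = t := by
  apply le_antisymm
  · refine (infDist_le_dist_of_mem hc).trans ?_
    rw [dist_eq_norm, add_sub_cancel_left, norm_smul, hν, mul_one, Real.norm_of_nonneg ht]
  · have h1 := infDist_le_infDist_add_dist (s := C) (x := c + r • ν) (y := c + t • ν)
    have h2 : dist (c + r • ν) (c + t • ν) = r - t := by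
      rw [dist_eq_norm, add_sub_add_left_eq_sub, ← sub_smul, norm_smul, hν, mul_one,
        Real.norm_of_nonneg (by linarith)]
    rw [h, h2] at h1
    linarith

/-- A point whose normal segment extends while realizing the distance has a unique foot point. -/
theorem normal_eq_of_infDist_eq {C : Set V} {c₁ c₂ ν₁ ν₂ : V} (hc₂ : c₂ ∈ C) (hν₁ : ‖ν₁‖ = 1)
    (hν₂ : ‖ν₂‖ = 1) {t r : ℝ} (ht : 0 < t) (htr : t < r) (h : infDist (c₁ + r • ν₁) C = r)
    (hp : c₁ + t • ν₁ = c₂ + t • ν₂) : ν₁ = ν₂ := by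
  have h1 : r ≤ ‖(r - t) • ν₁ + t • ν₂‖ := by
    have := infDist_le_dist_of_mem (x := c₁ + r • ν₁) hc₂
    rw [h, dist_eq_norm] at this
    have hc : c₁ + r • ν₁ - c₂ = (r - t) • ν₁ + t • ν₂ := by
      rw [eq_sub_of_add_eq hp, sub_smul]
      abel
    rwa [hc] at this
  have h2 : r ^ 2 ≤ ‖(r - t) • ν₁ + t • ν₂‖ ^ 2 := by gcongr; linarith
  rw [norm_add_sq_real, norm_smul, norm_smul, hν₁, hν₂, inner_smul_left, inner_smul_right,
    Real.norm_of_nonneg ht.le, Real.norm_of_nonneg (by linarith : 0 ≤ r - t)] at h2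
  simp only [RCLike.conj_to_real] at h2
  have h3 : 1 ≤ ⟪ν₁, ν₂⟫ := by
    have : 0 < (r - t) * t := mul_pos (by linarith) ht
    by_contra hc
    push Not at hc
    nlinarith
  have h4 := real_inner_le_norm ν₁ ν₂
  rw [hν₁, hν₂, one_mul] at h4
  exact (inner_eq_one_iff_of_norm_eq_one hν₁ hν₂).1 (le_antisymm h4 h3)

/-- Moving transversally to the level set, towards the side of the normal, increases the
distance. -/
theorem eventually_lt_infDist {C : Set V} {p ν u : V} (hν : ‖ν‖ = 1) {t r : ℝ} (htr : t < r)
    (h : infDist (p + (r - t) • ν) C = r) (hu : 0 < ⟪ν, u⟫) :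
    ∀ᶠ η in nhdsWithin (0 : ℝ) (Set.Ioi 0), t < infDist (p + η • u) C := by
  have hpos : 0 < 2 * (r - t) * ⟪ν, u⟫ / (‖u‖ ^ 2 + 1) := by
    have : 0 < r - t := by linarith
    positivity
  filter_upwards [Ioo_mem_nhdsGT hpos] with η hη
  have hη2 := hη.2
  rw [lt_div_iff₀ (by positivity)] at hη2
  have h1 := infDist_le_infDist_add_dist (s := C) (x := p + (r - t) • ν) (y := p + η • u)
  have h2 : dist (p + (r - t) • ν) (p + η • u) < r - t := by
    rw [dist_eq_norm, add_sub_add_left_eq_sub]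
    refine lt_of_pow_lt_pow_left₀ 2 (by linarith) ?_
    rw [norm_sub_sq_real, norm_smul, norm_smul, hν, inner_smul_left, inner_smul_right,
      Real.norm_of_nonneg hη.1.le, Real.norm_of_nonneg (by linarith : 0 ≤ r - t)]
    simp only [RCLike.conj_to_real]
    nlinarith [hη.1, mul_lt_mul_of_pos_left hη2 hη.1, sq_nonneg η]
  linarith

end Normal

/-- A family of regular unit-normal fields along curves in a closed set. -/
structure NormalFamily (κ : Type) (C : Set (Eu 2)) where
  c : κ → ℝ → Eu 2
  ν : κ → ℝ → Eu 2
  mem : ∀ j s, c j s ∈ C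
  norm_ν : ∀ j s, ‖ν j s‖ = 1
  contDiff_c : ∀ j, ContDiff ℝ 1 (c j)
  contDiff_ν : ∀ j, ContDiff ℝ 1 (ν j)
  inner_deriv : ∀ j s, ⟪deriv (c j) s, ν j s⟫ = 0
  inj : ∀ j, ∀ s ∈ Set.Ico (0 : ℝ) 1, ∀ k, ∀ u ∈ Set.Ico (0 : ℝ) 1,
    c j s = c k u → ν j s = ν k u → j = k ∧ s = u

namespace NormalFamily

variable {κ : Type} {C : Set (Eu 2)} (Φ : NormalFamily κ C)

/-- The parallel curve at distance `t`. -/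
def curve (t : ℝ) (j : κ) (s : ℝ) : Eu 2 := Φ.c j s + t • Φ.ν j s

/-- Parameters where the distance is realized at least up to `t`. -/
def tight (t : ℝ) (j : κ) : Set ℝ := {s ∈ Set.Ico (0 : ℝ) 1 | infDist (Φ.curve t j s) C = t}

/-- Parameters where the distance is realized beyond `t`. -/
def extendable (t : ℝ) (j : κ) : Set ℝ := {s | ∃ r, t < r ∧ s ∈ Φ.tight r j}

theorem contDiff_curve (t : ℝ) (j : κ) : ContDiff ℝ 1 (Φ.curve t j) :=
  (Φ.contDiff_c j).add ((Φ.contDiff_ν j).const_smul t)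

theorem hasDerivAt_curve (t : ℝ) (j : κ) (s : ℝ) :
    HasDerivAt (Φ.curve t j) (deriv (Φ.curve t j) s) s :=
  ((Φ.contDiff_curve t j).differentiable (by norm_num) s).hasDerivAt

theorem continuous_deriv_curve (t : ℝ) (j : κ) : Continuous (deriv (Φ.curve t j)) :=
  (Φ.contDiff_curve t j).continuous_deriv le_rfl

theorem inner_deriv_curve (t : ℝ) (j : κ) (s : ℝ) :
    ⟪deriv (Φ.curve t j) s, Φ.ν j s⟫ = 0 := by
  have hc := ((Φ.contDiff_c j).differentiable (by norm_num) s).hasDerivAt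
  have hν := ((Φ.contDiff_ν j).differentiable (by norm_num) s).hasDerivAt
  have h1 : deriv (Φ.curve t j) s = deriv (Φ.c j) s + t • deriv (Φ.ν j) s :=
    (hc.add (hν.const_smul t)).deriv
  have h2 := hν.inner ℝ hν
  have h3 : (fun s => ⟪Φ.ν j s, Φ.ν j s⟫) = fun _ => (1 : ℝ) := by
    funext s
    rw [real_inner_self_eq_norm_sq, Φ.norm_ν, one_pow]
  rw [h3] at h2
  have h4 := h2.unique (hasDerivAt_const s (1 : ℝ))
  rw [real_inner_comm (deriv (Φ.ν j) s)] at h4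
  rw [h1, inner_add_left, Φ.inner_deriv, inner_smul_left]
  have : ⟪deriv (Φ.ν j) s, Φ.ν j s⟫ = 0 := by linarith
  rw [this]
  simp

theorem tight_anti {t r : ℝ} (ht : 0 ≤ t) (htr : t ≤ r) (j : κ) : Φ.tight r j ⊆ Φ.tight t j :=
  fun s hs => ⟨hs.1, infDist_add_smul_eq_of_le (Φ.mem j s) (Φ.norm_ν j s) ht htr hs.2⟩

theorem extendable_subset_tight {t : ℝ} (ht : 0 ≤ t) (j : κ) : Φ.extendable t j ⊆ Φ.tight t j :=
  fun _ ⟨_, hr, hs⟩ => Φ.tight_anti ht hr.le j hs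

theorem measurableSet_tight (t : ℝ) (j : κ) : MeasurableSet (Φ.tight t j) := by
  refine measurableSet_Ico.inter (IsClosed.measurableSet ?_)
  exact isClosed_eq ((continuous_infDist_pt C).comp (Φ.contDiff_curve t j).continuous)
    continuous_const

theorem measurableSet_extendable {t : ℝ} (ht : 0 ≤ t) (j : κ) :
    MeasurableSet (Φ.extendable t j) := by
  have : Φ.extendable t j = ⋃ n : ℕ, Φ.tight (t + 1 / (n + 1)) j := by
    ext s
    rw [Set.mem_iUnion]
    constructor
    · rintro ⟨r, hr, hs⟩
      obtain ⟨n, hn⟩ := exists_nat_one_div_lt (sub_pos.2 hr)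
      have : (0 : ℝ) < 1 / (n + 1) := by positivity
      exact ⟨n, Φ.tight_anti (by linarith) (by linarith) j hs⟩
    · rintro ⟨n, hs⟩
      exact ⟨_, by linarith [show (0 : ℝ) < 1 / (n + 1) by positivity], hs⟩
  rw [this]
  exact MeasurableSet.iUnion fun n => Φ.measurableSet_tight _ _

theorem countable_tight_diff_extendable (j : κ) :
    {t : ℝ | 0 < t ∧ volume (Φ.tight t j \ Φ.extendable t j) ≠ 0}.Countable := by
  set A : Set.Ioi (0 : ℝ) → Set ℝ := fun t => Φ.tight t j \ Φ.extendable t j with hA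
  have hlt : ∀ t u : Set.Ioi (0 : ℝ), (t : ℝ) < u → Disjoint (A t) (A u) := by
    intro t u htu
    rw [Set.disjoint_left]
    rintro s ⟨-, hs⟩ ⟨hs', -⟩
    exact hs ⟨u, htu, hs'⟩
  have hdisj : Pairwise (Function.onFun Disjoint A) := by
    intro t u htu
    rcases lt_or_gt_of_ne (fun h => htu (Subtype.ext h) : (t : ℝ) ≠ u) with h | h
    · exact hlt t u h
    · exact (hlt u t h).symm
  have h := Measure.countable_meas_pos_of_disjoint_iUnion (μ := (volume : Measure ℝ)) (As := A)
    (fun t => (Φ.measurableSet_tight _ _).diff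
      (Φ.measurableSet_extendable (le_of_lt t.2) _)) hdisj
  refine (h.image Subtype.val).mono ?_
  rintro t ⟨ht, hv⟩
  exact ⟨⟨t, ht⟩, pos_iff_ne_zero.2 hv, rfl⟩

/-- The parallel curves meet a line at rising points only. -/
theorem sum_cnt_extendable_le [Fintype κ] {t : ℝ} (ht : 0 < t) (θ y : ℝ) :
    ∑ j, cnt {s ∈ Φ.extendable t j | (rotFrame θ).h (Φ.curve t j s) = y ∧
        (rotFrame θ).h (deriv (Φ.curve t j) s) ≠ 0} ≤
      cnt ((rotFrame θ).riseSet C t y) + cnt ((rotFrame θ).mirror.riseSet C t y) := by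
  set F := rotFrame θ with hF
  refine sum_cnt_le_cnt_add_cnt_neg (e := fun j s => F.ξ (Φ.curve t j s)) ?_ ?_
  · rintro j s ⟨⟨r, hr, hs⟩, hsy, -⟩ k u ⟨⟨r', hr', hu⟩, huy, -⟩ h
    have hp : Φ.curve t j s = Φ.curve t k u := by
      rw [← F.pt_h (Φ.curve t j s), ← F.pt_h (Φ.curve t k u), hsy, huy, h]
    have hν := normal_eq_of_infDist_eq (Φ.mem k u) (Φ.norm_ν j s) (Φ.norm_ν k u) ht hr hs.2 hp
    refine Φ.inj j s hs.1 k u hu.1 ?_ hν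
    have hp' : Φ.c j s + t • Φ.ν j s = Φ.c k u + t • Φ.ν k u := hp
    rw [hν] at hp'
    exact add_right_cancel hp'
  · rintro j s ⟨hext, hsy, hreg⟩
    have htight := (Φ.extendable_subset_tight ht.le j hext).2
    obtain ⟨r, hr, hs⟩ := hext
    set p := Φ.curve t j s with hp
    set u : Eu 2 := !₂[-sin θ, cos θ] with hu
    have hpr : infDist (p + (r - t) • Φ.ν j s) C = r := by
      rw [← hs.2, hs.2, hp, curve, add_assoc, ← add_smul, add_sub_cancel]
      exact hs.2
    have hpt : ∀ η, F.pt y (F.ξ p + η) = p + η • u := fun η => by rw [← hsy, hF, rotFrame_pt_add]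
    have hpt0 : F.pt y (F.ξ p) = p := by rw [← hsy, F.pt_h]
    have hne : ⟪Φ.ν j s, u⟫ ≠ 0 := by
      intro h0
      have h1 := Φ.inner_deriv_curve t j s
      have h2 := Φ.norm_ν j s
      apply hreg
      rw [Eu.inner_eq] at h0 h1
      have h3 := Eu.norm_sq (Φ.ν j s)
      rw [h2] at h3
      simp only [hu, Matrix.cons_val_zero, Matrix.cons_val_one] at h0
      simp only [hF, rotFrame]
      set a := Φ.ν j s 0
      set b := Φ.ν j s 1
      set d := deriv (Φ.curve t j) s 0
      set e := deriv (Φ.curve t j) s 1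
      have hk : (a * cos θ + b * sin θ) ^ 2 = 1 := by
        linear_combination -h3 - (a * -sin θ + b * cos θ) * h0 +
          (a ^ 2 + b ^ 2) * Real.sin_sq_add_cos_sq θ
      have hk0 : a * cos θ + b * sin θ ≠ 0 := fun h => by rw [h] at hk; norm_num at hk
      refine (mul_eq_zero.1 ?_).resolve_left hk0
      linear_combination h1 + (d * sin θ - e * cos θ) * h0 +
        (d * a + e * b) * (Real.sin_sq_add_cos_sq θ)
    rcases lt_or_gt_of_ne hne with hneg | hpos
    · right
      have hneg' : 0 < ⟪Φ.ν j s, -u⟫ := by rw [inner_neg_right]; linarith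
      refine ⟨?_, ?_⟩
      · change infDist (F.pt y (- -F.ξ p)) C = t
        rw [neg_neg, hpt0]
        exact htight
      · filter_upwards [eventually_lt_infDist (Φ.norm_ν j s) hr hpr hneg'] with η hη
        change t < infDist (F.pt y (-(-F.ξ p + η))) C
        rw [neg_add, neg_neg, hpt, neg_smul, ← smul_neg]
        exact hη
    · left
      refine ⟨?_, ?_⟩
      · rw [hpt0]
        exact htight
      · filter_upwards [eventually_lt_infDist (Φ.norm_ν j s) hr hpr hpos] with η hη
        rw [hpt]
        exact hη

end NormalFamily

/-- The unit normal of a plane curve, on the side given by the Boolean. -/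
def unitNormal (γ : ℝ → Eu 2) (b : Bool) (s : ℝ) : Eu 2 :=
  ((if b then (1 : ℝ) else -1) * ‖deriv γ s‖⁻¹) • quarterTurn (deriv γ s)

theorem norm_unitNormal {γ : ℝ → Eu 2} (hγ : IsC2JordanCurve γ) (b : Bool) (s : ℝ) :
    ‖unitNormal γ b s‖ = 1 := by
  have h := norm_ne_zero_iff.2 (hγ.2.2.2 s)
  rw [unitNormal, norm_smul, norm_quarterTurn, norm_mul, norm_inv, norm_norm, mul_assoc,
    inv_mul_cancel₀ h, mul_one]
  cases b <;> simp

theorem contDiff_unitNormal {γ : ℝ → Eu 2} (hγ : IsC2JordanCurve γ) (b : Bool) :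
    ContDiff ℝ 1 (unitNormal γ b) := by
  have h1 : ContDiff ℝ 1 fun s => ‖deriv γ s‖⁻¹ :=
    (hγ.contDiff_deriv.norm ℝ hγ.2.2.2).inv fun s => norm_ne_zero_iff.2 (hγ.2.2.2 s)
  exact (contDiff_const.mul h1).smul (quarterTurn.contDiff.comp hγ.contDiff_deriv)

theorem inner_deriv_unitNormal (γ : ℝ → Eu 2) (b : Bool) (s : ℝ) :
    ⟪deriv γ s, unitNormal γ b s⟫ = 0 := by
  rw [unitNormal, inner_smul_right, real_inner_comm, inner_quarterTurn, mul_zero]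

theorem unitNormal_false (γ : ℝ → Eu 2) (s : ℝ) : unitNormal γ false s = -unitNormal γ true s := by
  simp [unitNormal]

theorem unitNormal_injective {γ : ℝ → Eu 2} (hγ : IsC2JordanCurve γ) {b b' : Bool} {s : ℝ}
    (h : unitNormal γ b s = unitNormal γ b' s) : b = b' := by
  have h0 : unitNormal γ true s ≠ 0 := by
    rw [← norm_ne_zero_iff, norm_unitNormal hγ]
    exact one_ne_zero
  have h1 : ∀ v : Eu 2, -v = v → v = 0 := fun v hv => Eu.ext_two
    (self_eq_neg.1 (congrArg (fun w : Eu 2 => w 0) hv).symm)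
    (self_eq_neg.1 (congrArg (fun w : Eu 2 => w 1) hv).symm)
  cases b <;> cases b' <;> simp only [unitNormal_false] at h ⊢
  · exact (h0 (h1 _ h)).elim
  · exact (h0 (h1 _ h.symm)).elim

/-- A vector of length `t` orthogonal to a curve is a multiple of a unit normal. -/
theorem exists_eq_smul_unitNormal {γ : ℝ → Eu 2} (hγ : IsC2JordanCurve γ) {s t : ℝ} {v : Eu 2}
    (hv : ‖v‖ = t) (h : ⟪v, deriv γ s⟫ = 0) : ∃ b, v = t • unitNormal γ b s := by
  have hd := norm_ne_zero_iff.2 (hγ.2.2.2 s)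
  set w := deriv γ s with hw
  set a := ⟪quarterTurn w, v⟫ * ‖w‖⁻¹ with ha
  have hw2 := Eu.norm_sq w
  have hva : v = (a * ‖w‖⁻¹) • quarterTurn w := by
    rw [Eu.inner_eq] at h
    rw [ha, Eu.inner_eq, quarterTurn_zero_apply, quarterTurn_one_apply]
    have hi : ‖w‖⁻¹ * ‖w‖⁻¹ * (w 0 ^ 2 + w 1 ^ 2) = 1 := by
      rw [← hw2]
      field_simp
    apply Eu.ext_two
    · rw [PiLp.smul_apply, quarterTurn_zero_apply, smul_eq_mul]
      linear_combination -v 0 * hi + w 0 * ‖w‖⁻¹ * ‖w‖⁻¹ * h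
    · rw [PiLp.smul_apply, quarterTurn_one_apply, smul_eq_mul]
      linear_combination -v 1 * hi + w 1 * ‖w‖⁻¹ * ‖w‖⁻¹ * h
  have hta : |a| = t := by
    rw [← hv, hva, norm_smul, norm_quarterTurn, norm_mul, norm_inv, norm_norm, mul_assoc,
      inv_mul_cancel₀ hd, mul_one, Real.norm_eq_abs]
  rcases abs_choice a with h' | h'
  · refine ⟨true, ?_⟩
    rw [unitNormal, smul_smul, ← hw]
    nth_rewrite 1 [hva]
    rw [← hta, h']
    simp
  · refine ⟨false, ?_⟩
    rw [unitNormal, smul_smul, ← hw]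
    nth_rewrite 1 [hva]
    rw [← hta, h']
    simp

/-- The two unit normals along disjoint Jordan curves. -/
def jordanNormalFamily {ι : Type} {γ : ι → ℝ → Eu 2} (hγ : ∀ i, IsC2JordanCurve (γ i))
    (hdisj : ∀ i j, i ≠ j → Disjoint (Set.range (γ i)) (Set.range (γ j))) {C : Set (Eu 2)}
    (hC : ∀ i s, γ i s ∈ C) : NormalFamily (ι × Bool) C where
  c j := γ j.1
  ν j := unitNormal (γ j.1) j.2
  mem j s := hC j.1 s
  norm_ν j s := norm_unitNormal (hγ j.1) j.2 s
  contDiff_c j := (hγ j.1).1.of_le (by norm_num)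
  contDiff_ν j := contDiff_unitNormal (hγ j.1) j.2
  inner_deriv j s := inner_deriv_unitNormal (γ j.1) j.2 s
  inj := by
    rintro ⟨i, b⟩ s hs ⟨k, b'⟩ u hu hc hν
    have hik : i = k := by
      by_contra hik
      exact Set.disjoint_left.1 (hdisj i k hik) ⟨s, rfl⟩ ⟨u, hc.symm⟩
    subst hik
    have hsu : s = u := (hγ i).2.2.1 s hs u hu hc
    subst hsu
    exact ⟨Prod.ext rfl (unitNormal_injective (hγ i) hν), rfl⟩

/-- The segment to a nearest point of a curve is orthogonal to the curve. -/
theorem inner_deriv_eq_zero_of_dist_le {γ : ℝ → Eu 2} (hγ : IsC2JordanCurve γ) {x : Eu 2} {s : ℝ}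
    (h : ∀ u, dist x (γ s) ≤ dist x (γ u)) : ⟪x - γ s, deriv γ s⟫ = 0 := by
  have hd := ((hγ.hasDerivAt s).const_sub x).norm_sq
  have hmin : IsLocalMin (fun u => ‖x - γ u‖ ^ 2) s := by
    refine Eventually.of_forall fun u => ?_
    have := h u
    rw [dist_eq_norm, dist_eq_norm] at this
    change ‖x - γ s‖ ^ 2 ≤ ‖x - γ u‖ ^ 2
    gcongr
  have h0 := hmin.hasDerivAt_eq_zero hd
  rw [inner_neg_right] at h0
  linarith

theorem exists_mem_tight {ι : Type} {γ : ι → ℝ → Eu 2} (hγ : ∀ i, IsC2JordanCurve (γ i))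
    (hdisj : ∀ i j, i ≠ j → Disjoint (Set.range (γ i)) (Set.range (γ j))) {U : Set (Eu 2)}
    (hU : U.Nonempty) (hfr : frontier U = ⋃ i, Set.range (γ i))
    (hC : ∀ i s, γ i s ∈ closure U) {x : Eu 2} (hx : x ∉ closure U) :
    ∃ j, ∃ s ∈ (jordanNormalFamily hγ hdisj hC).tight (infDist x (closure U)) j,
      (jordanNormalFamily hγ hdisj hC).curve (infDist x (closure U)) j s = x := by
  obtain ⟨-, z, hz, hxz⟩ := infDist_eq_infDist_frontier hU hx
  rw [hfr] at hz
  obtain ⟨i, hi⟩ := Set.mem_iUnion.1 hz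
  rw [(hγ i).range_eq] at hi
  obtain ⟨s, hs, rfl⟩ := hi
  have h0 := inner_deriv_eq_zero_of_dist_le (hγ i) (x := x) (s := s) fun u => by
    rw [hxz]
    exact infDist_le_dist_of_mem (hC i u)
  obtain ⟨b, hb⟩ := exists_eq_smul_unitNormal (hγ i) (by rw [← dist_eq_norm, hxz]) h0
  have hcurve : (jordanNormalFamily hγ hdisj hC).curve (infDist x (closure U)) (i, b) s = x := by
    rw [NormalFamily.curve]
    change γ i s + _ • unitNormal (γ i) b s = x
    rw [← hb]
    abel
  refine ⟨(i, b), s, ⟨hs, ?_⟩, hcurve⟩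
  rw [hcurve]

theorem continuous_rotFrame_h : Continuous fun p : ℝ × Eu 2 => (rotFrame p.1).h p.2 := by
  simp only [rotFrame]
  fun_prop

theorem measurable_lintegral_rotFrame_h {v : ℝ → Eu 2} (hv : Continuous v) (S : Set ℝ) :
    Measurable fun θ => ∫⁻ s in S, ‖(rotFrame θ).h (v s)‖ₑ := by
  refine Measurable.lintegral_prod_right' (f := fun p : ℝ × ℝ => ‖(rotFrame p.1).h (v p.2)‖ₑ) ?_
  have : Continuous fun p : ℝ × ℝ => (rotFrame p.1).h (v p.2) :=
    continuous_rotFrame_h.comp (continuous_fst.prodMk (hv.comp continuous_snd))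
  exact this.enorm.measurable

/-- Averaging the lengths of the projections over all directions. -/
theorem lintegral_lintegral_rotFrame_h {v : ℝ → Eu 2} (hv : Continuous v) (S : Set ℝ) :
    ∫⁻ θ in Set.Ioc 0 (2 * π), ∫⁻ s in S, ‖(rotFrame θ).h (v s)‖ₑ = 4 * ∫⁻ s in S, ‖v s‖ₑ := by
  have hcont : Continuous fun p : ℝ × ℝ => (rotFrame p.1).h (v p.2) :=
    continuous_rotFrame_h.comp (continuous_fst.prodMk (hv.comp continuous_snd))
  rw [lintegral_lintegral_swap hcont.enorm.measurable.aemeasurable,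
    ← lintegral_const_mul _ hv.enorm.measurable]
  refine lintegral_congr fun s => ?_
  have := lintegral_direction (v s 0) (v s 1)
  rw [← Eu.norm_sq, Real.sqrt_sq (norm_nonneg _), ofReal_norm] at this
  exact this

/-- The integral inequality in a fixed direction. -/
theorem lintegral_projection_add_le {ι : Type} [Fintype ι] {γ : ι → ℝ → Eu 2}
    (hγ : ∀ i, IsC2JordanCurve (γ i)) {U : Set (Eu 2)} (hUc : IsPreconnected U)
    (hfr : frontier U = ⋃ i, Set.range (γ i))
    (hside : ∀ i s n, (∀ a b : ℝ, a • deriv (γ i) s + b • n = 0 → a = 0 ∧ b = 0) →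
        ∃ σ : ℝ, (σ = 1 ∨ σ = -1) ∧ ∃ δ > 0, ∀ r, 0 < r → r < δ → γ i s + (σ * r) • n ∈ U)
    {M : ℝ} (hM : (closedBall (0 : Eu 2) M)ᶜ ⊆ U) (hne : U.Nonempty)
    {κ : Type} [Fintype κ] (Φ : NormalFamily κ (closure U))
    {t : ℝ} (ht : 0 < t) {w₀ : Eu 2} (hw₀ : t < infDist w₀ (closure U)) (θ : ℝ) :
    (∑ j, ∫⁻ s in Φ.extendable t j, ‖(rotFrame θ).h (deriv (Φ.curve t j) s)‖ₑ) +
        4 * ENNReal.ofReal t ≤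
      ∑ i, ∫⁻ s in Set.Ico (0 : ℝ) 1, ‖(rotFrame θ).h (deriv (γ i) s)‖ₑ := by
  have hcont : Continuous (rotFrame θ).h := (rotFrame θ).continuous_h
  have hbound : ∀ x ∉ closure U, ‖x‖ ≤ M := by
    intro x hx
    by_contra hc
    exact hx (subset_closure (hM (by simpa using hc)))
  have h0 : (rotFrame θ).h 0 = 0 := by simp [rotFrame]
  have hξ0 : (rotFrame θ).ξ 0 = 0 := by simp [rotFrame]
  have hκ := fun j => lintegral_cnt_fiber
    (fun s => hasDerivAt_rotFrame_h θ (Φ.hasDerivAt_curve t j s))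
    (hcont.comp (Φ.continuous_deriv_curve t j)) (Φ.measurableSet_extendable ht.le j)
  have hι := fun i => lintegral_cnt_fiber
    (fun s => hasDerivAt_rotFrame_h θ ((hγ i).hasDerivAt s))
    (hcont.comp (hγ i).contDiff_deriv.continuous) (measurableSet_Ico (a := (0 : ℝ)) (b := 1))
  have key := (rotFrame θ).lintegral_rise_add_le (C := closure U) isClosed_closure hUc.closure
    hne.closure (M := M + 1) ?_ ?_ ht hw₀
    (Finset.measurable_fun_sum Finset.univ fun j _ => (hκ j).1).aemeasurable
    (Finset.measurable_fun_sum Finset.univ fun i _ => (hι i).1).aemeasurable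
    (Eventually.of_forall fun y => Φ.sum_cnt_extendable_le ht θ y) ?_
  · rw [lintegral_finsetSum _ fun j _ => (hκ j).1, lintegral_finsetSum _ fun i _ => (hι i).1,
      Finset.sum_congr rfl fun j _ => (hκ j).2, Finset.sum_congr rfl fun i _ => (hι i).2] at key
    exact key
  · intro x hx
    have := (rotFrame θ).abs_ξ_sub_le x 0
    rw [hξ0, sub_zero, dist_zero_right] at this
    linarith [hbound x hx]
  · intro x hx
    have := (rotFrame θ).abs_h_sub_le x 0
    rw [h0, sub_zero, dist_zero_right] at this
    linarith [hbound x hx]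
  · have hreg := ae_all_iff.2 fun i => ae_regular_value
      (fun s => hasDerivAt_rotFrame_h θ ((hγ i).hasDerivAt s))
      (hcont.comp (hγ i).contDiff_deriv.continuous)
    filter_upwards [hreg] with y hy
    exact cnt_entrySet_add_le hγ hfr hside θ hy

/-- The total length of the extendable parts of the parallel curves. -/
theorem sum_lintegral_extendable_add_le {ι : Type} [Fintype ι] {γ : ι → ℝ → Eu 2}
    (hγ : ∀ i, IsC2JordanCurve (γ i)) {U : Set (Eu 2)} (hUc : IsPreconnected U)
    (hfr : frontier U = ⋃ i, Set.range (γ i))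
    (hside : ∀ i s n, (∀ a b : ℝ, a • deriv (γ i) s + b • n = 0 → a = 0 ∧ b = 0) →
        ∃ σ : ℝ, (σ = 1 ∨ σ = -1) ∧ ∃ δ > 0, ∀ r, 0 < r → r < δ → γ i s + (σ * r) • n ∈ U)
    {M : ℝ} (hM : (closedBall (0 : Eu 2) M)ᶜ ⊆ U) (hne : U.Nonempty)
    {κ : Type} [Fintype κ] (Φ : NormalFamily κ (closure U))
    {t : ℝ} (ht : 0 < t) {w₀ : Eu 2} (hw₀ : t < infDist w₀ (closure U)) :
    (∑ j, ∫⁻ s in Φ.extendable t j, ‖deriv (Φ.curve t j) s‖ₑ) + ENNReal.ofReal (2 * π * t) ≤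
      ∑ i, ∫⁻ s in Set.Ico (0 : ℝ) 1, ‖deriv (γ i) s‖ₑ := by
  have h := lintegral_mono (μ := volume.restrict (Set.Ioc 0 (2 * π)))
    (lintegral_projection_add_le hγ hUc hfr hside hM hne Φ ht hw₀)
  have hmκ := fun j => measurable_lintegral_rotFrame_h (Φ.continuous_deriv_curve t j)
    (Φ.extendable t j)
  have hmι := fun i => measurable_lintegral_rotFrame_h (hγ i).contDiff_deriv.continuous
    (Set.Ico (0 : ℝ) 1)
  rw [lintegral_add_right _ measurable_const, lintegral_finsetSum _ fun j _ => hmκ j,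
    lintegral_finsetSum _ fun i _ => hmι i,
    Finset.sum_congr rfl fun j _ =>
      lintegral_lintegral_rotFrame_h (Φ.continuous_deriv_curve t j) (Φ.extendable t j),
    Finset.sum_congr rfl fun i _ =>
      lintegral_lintegral_rotFrame_h (hγ i).contDiff_deriv.continuous (Set.Ico (0 : ℝ) 1),
    ← Finset.mul_sum, ← Finset.mul_sum, setLIntegral_const, Real.volume_Ioc, sub_zero, mul_assoc,
    ← ENNReal.ofReal_mul ht.le, ← mul_add, mul_comm t] at h
  exact (ENNReal.mul_le_mul_iff_right (by norm_num) (by norm_num)).1 h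

/-- The level sets of the distance are covered by the parallel curves. -/
theorem hausdorffMeasure_level_le {ι : Type} [Fintype ι] {γ : ι → ℝ → Eu 2}
    (hγ : ∀ i, IsC2JordanCurve (γ i))
    (hdisj : ∀ i j, i ≠ j → Disjoint (Set.range (γ i)) (Set.range (γ j))) {U : Set (Eu 2)}
    (hU : U.Nonempty) (hfr : frontier U = ⋃ i, Set.range (γ i)) (hC : ∀ i s, γ i s ∈ closure U)
    {t : ℝ} (ht : 0 < t) (hreg : ∀ j, volume ((jordanNormalFamily hγ hdisj hC).tight t j \
      (jordanNormalFamily hγ hdisj hC).extendable t j) = 0) :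
    μH[1] {x | infDist x (closure U) = t} ≤
      ∑ j, ∫⁻ s in (jordanNormalFamily hγ hdisj hC).extendable t j,
        ‖deriv ((jordanNormalFamily hγ hdisj hC).curve t j) s‖ₑ := by
  set Φ := jordanNormalFamily hγ hdisj hC with hΦ
  have hcover : {x | infDist x (closure U) = t} ⊆
      ⋃ j ∈ (Finset.univ : Finset (ι × Bool)), Φ.curve t j '' Φ.tight t j := by
    rintro x rfl
    have hx : x ∉ closure U := fun hx => by
      rw [infDist_zero_of_mem hx] at ht
      exact lt_irrefl _ ht
    obtain ⟨j, s, hs, hsx⟩ := exists_mem_tight hγ hdisj hU hfr hC hx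
    exact Set.mem_iUnion₂.2 ⟨j, Finset.mem_univ j, s, hs, hsx⟩
  refine (measure_mono hcover).trans ((measure_biUnion_finset_le _ _).trans
    (Finset.sum_le_sum fun j _ => ?_))
  have hfin : volume (Φ.tight t j) ≠ ⊤ :=
    ((measure_mono (fun s hs => hs.1)).trans_lt (measure_Ico_lt_top (a := (0 : ℝ)) (b := 1))).ne
  refine (hausdorffMeasure_image_le_lintegral (Φ.hasDerivAt_curve t j)
    (Φ.continuous_deriv_curve t j) (Φ.measurableSet_tight t j) hfin).trans (le_of_eq ?_)
  refine setLIntegral_congr (Filter.EventuallyLE.antisymm ?_ ?_)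
  · exact ae_le_set.2 (hreg j)
  · exact (Φ.extendable_subset_tight ht.le j).eventuallyLE

theorem sum_lintegral_le_hausdorffMeasure {ι : Type} [Fintype ι] {γ : ι → ℝ → Eu 2}
    (hγ : ∀ i, IsC2JordanCurve (γ i))
    (hdisj : ∀ i j, i ≠ j → Disjoint (Set.range (γ i)) (Set.range (γ j))) :
    ∑ i, ∫⁻ s in Set.Ico (0 : ℝ) 1, ‖deriv (γ i) s‖ₑ ≤ μH[1] (⋃ i, Set.range (γ i)) := by
  rw [measure_iUnion (fun i j hij => hdisj i j hij)
    fun i => (hγ i).isCompact_range.isClosed.measurableSet, tsum_fintype]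
  refine Finset.sum_le_sum fun i _ => ?_
  rw [(hγ i).range_eq]
  exact lintegral_le_hausdorffMeasure_image (hγ i).hasDerivAt (hγ i).contDiff_deriv.continuous
    measurableSet_Ico measure_Ico_lt_top.ne (hγ i).2.2.1

theorem hausdorffMeasure_iUnion_range_lt_top {ι : Type} [Fintype ι] {γ : ι → ℝ → Eu 2}
    (hγ : ∀ i, IsC2JordanCurve (γ i)) : μH[1] (⋃ i, Set.range (γ i)) < ⊤ := by
  refine (measure_iUnion_fintype_le _ _).trans_lt (ENNReal.sum_lt_top.2 fun i _ => ?_)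
  rw [(hγ i).range_eq]
  refine (hausdorffMeasure_image_le_lintegral (hγ i).hasDerivAt (hγ i).contDiff_deriv.continuous
    measurableSet_Ico measure_Ico_lt_top.ne).trans_lt ?_
  obtain ⟨B, hB⟩ := isCompact_Icc.exists_bound_of_continuousOn (s := Set.Icc (0 : ℝ) 1)
    (hγ i).contDiff_deriv.continuous.continuousOn
  refine (setLIntegral_mono measurable_const fun s hs =>
    (show ‖deriv (γ i) s‖ₑ ≤ ENNReal.ofReal B from ?_)).trans_lt ?_
  · rw [← ofReal_norm]
    exact ENNReal.ofReal_le_ofReal (hB s (Set.Ico_subset_Icc_self hs))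
  · rw [setLIntegral_const]
    exact ENNReal.mul_lt_top ENNReal.ofReal_lt_top measure_Ico_lt_top

theorem level_length_upper_bound
    (Ω : Set (Eu 2)) (hΩ : IsC2Domain Ω) :
    ∀ᵐ t ∂(volume : Measure ℝ), t ∈ Set.Icc 0 (innerRadius Ω) →
      lenFn Ω t ≤ outerPerim Ω - 2 * π * t := by
  obtain ⟨ι, _, γ, hγ, hdisj, hfr, hside⟩ := hΩ.exists_outer_curves
  obtain ⟨hΩo, hΩc, hΩb, -⟩ := hΩ
  obtain ⟨M, hM⟩ := hΩb.closure.subset_closedBall (0 : Eu 2)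
  set U := unboundedPart Ω with hU
  have hMU : (closedBall (0 : Eu 2) M)ᶜ ⊆ U := compl_closedBall_subset_unboundedPart hM
  have hne : U.Nonempty := by
    refine Set.Nonempty.mono hMU (Set.nonempty_iff_ne_empty.2 fun hc => ?_)
    exact not_isBounded_compl_closedBall M (by rw [hc]; exact Bornology.isBounded_empty)
  have hUc : IsPreconnected U := isPreconnected_unboundedPart hM
  have hC : ∀ i s, γ i s ∈ closure U := fun i s => frontier_subset_closure (by
    change γ i s ∈ outerBoundary Ω
    rw [hfr]
    exact Set.mem_iUnion.2 ⟨i, s, rfl⟩)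
  set Φ := jordanNormalFamily hγ hdisj hC with hΦ
  have hae : ∀ᵐ t : ℝ, ∀ j, ¬ (0 < t ∧ volume (Φ.tight t j \ Φ.extendable t j) ≠ 0) :=
    ae_all_iff.2 fun j => (Φ.countable_tight_diff_extendable j).ae_notMem _
  filter_upwards [hae, Measure.ae_ne volume (0 : ℝ), Measure.ae_ne volume (innerRadius Ω)]
    with t htreg ht0 htR htmem
  have ht : 0 < t := lt_of_le_of_ne htmem.1 (Ne.symm ht0)
  obtain ⟨w₀, hw₀⟩ := exists_lt_infDist_of_lt_innerRadius hΩo hΩc.nonempty hne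
    (lt_of_le_of_ne htmem.2 htR)
  have h1 : μH[1] {x ∈ Ω | infDist x (outerBoundary Ω) = t} ≤
      μH[1] {x | infDist x (closure U) = t} := by
    refine measure_mono fun x hx => ?_
    have := (infDist_eq_infDist_frontier hne (subset_innerRegion hΩo hx.1)).1
    exact this.symm.trans hx.2
  have h2 := hausdorffMeasure_level_le hγ hdisj hne hfr hC ht fun j => by
    by_contra hc
    exact htreg j ⟨ht, hc⟩
  have h3 := sum_lintegral_extendable_add_le hγ hUc hfr hside hMU hne Φ ht hw₀
  have h4 := sum_lintegral_le_hausdorffMeasure hγ hdisj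
  have h5 := hausdorffMeasure_iUnion_range_lt_top hγ
  rw [← hfr] at h4 h5
  have h6 : μH[1] {x ∈ Ω | infDist x (outerBoundary Ω) = t} + ENNReal.ofReal (2 * π * t) ≤
      μH[1] (outerBoundary Ω) :=
    ((add_le_add (h1.trans h2) le_rfl).trans h3).trans h4
  have h7 := ENNReal.toReal_mono h5.ne h6
  rw [ENNReal.toReal_add ((le_self_add.trans h6).trans_lt h5).ne ENNReal.ofReal_ne_top,
    ENNReal.toReal_ofReal (by positivity)] at h7
  rw [lenFn, outerPerim]
  linarith

end
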